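/- Let ℓ, m be positive integers. For any set A ⊆ ℕ with lower density d_(A) > 1/2, there exist an infinite set B ⊆ ℕ and a positive integer t such that {m·b₁ + ℓ·b₂ : b₁, b₂ ∈ B and b₁ ≤ b₂} + t ⊆ A. -/

import Mathlib

open Filter MeasureTheory Topology

open scoped Classical in
/-- Upper Banach density: `limsup` over window length `N` of the maximal count of
elements of `A` in a window of length `N`, divided by `N`. -/
noncomputable def upperBanachDensity (A : Set ℕ) : ℝ :=
  Filter.limsup
    (fun N : ℕ => ⨆ M : ℕ, (((Finset.Ico M (M + N)).filter (· ∈ A)).card : ℝ) / N)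
    Filter.atTop

open scoped Classical in
/-- Natural upper density of a set of naturals. -/
noncomputable def upperDensity (A : Set ℕ) : ℝ :=
  Filter.limsup (fun N : ℕ => (((Finset.Icc 1 N).filter (· ∈ A)).card : ℝ) / N)
    Filter.atTop

open scoped Classical in
/-- Natural lower density of a set of naturals. -/
noncomputable def lowerDensity (A : Set ℕ) : ℝ :=
  Filter.liminf (fun N : ℕ => (((Finset.Icc 1 N).filter (· ∈ A)).card : ℝ) / N)
    Filter.atTop

open Filter MeasureTheory Topology

namespace MBLB

open scoped ComplexOrder BoundedContinuousFunction ComplexConjugate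

/-- bounded complex sequences -/
abbrev BF := BoundedContinuousFunction ℕ ℂ

/-- build a bounded sequence -/
noncomputable def bf (f : ℕ → ℂ) (C : ℝ) (h : ∀ n, ‖f n‖ ≤ C) : BF :=
  BoundedContinuousFunction.ofNormedAddCommGroupDiscrete f C h

@[simp] lemma bf_apply (f : ℕ → ℂ) (C : ℝ) (h : ∀ n, ‖f n‖ ≤ C) (n : ℕ) : bf f C h n = f n := rfl

/-- the shift -/
noncomputable def sh : BF →ₗ[ℂ] BF where
  toFun f := bf (fun n => f (n + 1)) ‖f‖ (fun n => f.norm_coe_le_norm _)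
  map_add' f g := by ext n; simp
  map_smul' c f := by ext n; simp

@[simp] lemma sh_apply (f : BF) (n : ℕ) : sh f n = f (n + 1) := rfl

/-- invariant means -/
structure IsMean (M : BF →ₗ[ℂ] ℂ) : Prop where
  pos : ∀ f : BF, (∀ n, 0 ≤ f n) → 0 ≤ M f
  one : M 1 = 1
  shift : ∀ f, M (sh f) = M f

/-- positive functionals -/
def IsPos (M : BF →ₗ[ℂ] ℂ) : Prop := ∀ f : BF, (∀ n, 0 ≤ f n) → 0 ≤ M f

section pos
variable {M : BF →ₗ[ℂ] ℂ} (hM : IsPos M)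
include hM

lemma IsPos.im_eq_zero (f : BF) (hf : ∀ n, (f n).im = 0) : (M f).im = 0 := by
  have h1 : 0 ≤ M ((‖f‖ : ℂ) • (1 : BF)) := hM _ (fun n => by
    simp)
  have h2 : 0 ≤ M ((‖f‖ : ℂ) • (1 : BF) - f) := hM _ (fun n => by
    have := (Complex.re_le_norm (f n)).trans (f.norm_coe_le_norm n)
    rw [Complex.le_def]
    simp [hf n, this])
  rw [map_sub] at h2
  have a := (Complex.le_def.1 h1).2
  have b := (Complex.le_def.1 h2).2
  simp only [Complex.zero_im, Complex.sub_im] at a b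
  linarith

/-- real part function -/
lemma IsPos.map_star (f : BF) : M (star f) = conj (M f) := by
  let r : BF := bf (fun n => ((f n).re : ℂ)) ‖f‖ (fun n => by
    simpa using (Complex.abs_re_le_norm (f n)).trans (f.norm_coe_le_norm n))
  let i : BF := bf (fun n => ((f n).im : ℂ)) ‖f‖ (fun n => by
    simpa using (Complex.abs_im_le_norm (f n)).trans (f.norm_coe_le_norm n))
  have e1 : f = r + Complex.I • i := by
    ext n; simp [r, i, mul_comm Complex.I, Complex.re_add_im]
  have e2 : star f = r - Complex.I • i := by
    ext n
    apply Complex.ext <;> simp [r, i]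
  have hr := hM.im_eq_zero r (fun n => by simp [r])
  have hi := hM.im_eq_zero i (fun n => by simp [i])
  rw [e2, e1]
  apply Complex.ext <;> simp [hr, hi]

lemma IsPos.norm_le (f g : BF) (h : ∀ n, ‖f n‖ ≤ (g n).re) : ‖M f‖ ≤ (M g).re := by
  obtain ⟨u, hu, hu2⟩ : ∃ u : ℂ, ‖u‖ = 1 ∧ u * M f = ‖M f‖ := by
    by_cases h0 : M f = 0
    · exact ⟨1, by simp, by simp [h0]⟩
    · refine ⟨conj (M f) / ‖M f‖, by simp [h0], ?_⟩
      have : (‖M f‖ : ℂ) ≠ 0 := by simpa using h0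
      field_simp
      rw [mul_comm, Complex.mul_conj, Complex.normSq_eq_norm_sq]; push_cast; ring
  set k : BF := g - u • f with hk
  have h2 : 0 ≤ M (k + Star.star k) := hM _ (fun n => by
    have h3 : (u * f n).re ≤ (g n).re := by
      refine (Complex.re_le_norm _).trans ?_
      rw [norm_mul, hu, one_mul]; exact h n
    rw [Complex.le_def]
    constructor
    · simp only [hk, BoundedContinuousFunction.coe_add, BoundedContinuousFunction.coe_sub,
        BoundedContinuousFunction.coe_smul, BoundedContinuousFunction.star_apply, Pi.add_apply,
        Pi.sub_apply, smul_eq_mul, Complex.add_re, Complex.sub_re, Complex.star_def, Complex.conj_re, Complex.zero_re]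
      linarith
    · simp)
  rw [map_add, hM.map_star] at h2
  have a := (Complex.le_def.1 h2).1
  simp only [Complex.zero_re, Complex.add_re, Complex.conj_re, hk, map_sub, map_smul, smul_eq_mul, hu2, Complex.sub_re, Complex.ofReal_re] at a
  linarith

lemma IsPos.re_mono (f g : BF) (h : ∀ n, (f n).re ≤ (g n).re) : (M f).re ≤ (M g).re := by
  have := hM.norm_le 0 (g - f) (fun n => by simpa using h n)
  simp at this
  linarith

end pos

section mean
variable {M : BF →ₗ[ℂ] ℂ} (hM : IsMean M)
include hM

lemma IsMean.isPos : IsPos M := hM.pos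

lemma IsMean.norm_le_const (f : BF) (C : ℝ) (h : ∀ n, ‖f n‖ ≤ C) : ‖M f‖ ≤ C := by
  have := hM.isPos.norm_le f ((C : ℂ) • 1) (fun n => by simpa using h n)
  simpa [hM.one] using this

lemma IsMean.norm_le_norm (f : BF) : ‖M f‖ ≤ ‖f‖ :=
  hM.norm_le_const f _ (fun n => f.norm_coe_le_norm n)

lemma IsMean.shift_iter (k : ℕ) (f : BF) : M ((sh ^ k) f) = M f := by
  induction k with
  | zero => simp
  | succ k ih => rw [pow_succ', Module.End.mul_apply, hM.shift, ih]

end mean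

lemma sh_pow_apply (k : ℕ) (f : BF) (n : ℕ) : (sh ^ k) f n = f (n + k) := by
  induction k generalizing n with
  | zero => simp
  | succ k ih => rw [pow_succ', Module.End.mul_apply, sh_apply, ih]; congr 1; omega

/-- characters -/
noncomputable def ch (z : Circle) : BF := bf (fun n => ((z ^ n : Circle) : ℂ)) 1 (fun n => by rw [Circle.norm_coe])

lemma ch_apply (z : Circle) (n : ℕ) : ch z n = (z : ℂ) ^ n := by simp [ch]

@[simp] lemma norm_ch_apply (z : Circle) (n : ℕ) : ‖ch z n‖ = 1 := by
  rw [ch, bf_apply, Circle.norm_coe]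

lemma ch_mul (z w : Circle) : ch z * ch w = ch (z * w) := by
  ext n; simp [ch_apply, mul_pow]

lemma ch_one : ch 1 = 1 := by
  ext n; simp [ch_apply]

lemma ch_star (z : Circle) : star (ch z) = ch z⁻¹ := by
  ext n
  rw [BoundedContinuousFunction.star_apply, ch_apply, ch_apply, Circle.coe_inv_eq_conj, star_pow]; rfl

lemma sh_ch (z : Circle) : sh (ch z) = (z : ℂ) • ch z := by
  ext n; simp [ch_apply, pow_succ, mul_comm]

open Classical in
lemma IsMean.ch_eq {M : BF →ₗ[ℂ] ℂ} (hM : IsMean M) (z : Circle) :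
    M (ch z) = if z = 1 then 1 else 0 := by
  split_ifs with h
  · rw [h, ch_one, hM.one]
  · have h1 := hM.shift (ch z)
    rw [sh_ch, map_smul, smul_eq_mul] at h1
    have h2 : ((z : ℂ) - 1) * M (ch z) = 0 := by linear_combination h1
    rcases mul_eq_zero.1 h2 with h3 | h3
    · exfalso; apply h; ext; simpa [sub_eq_zero] using h3
    · exact h3

end MBLB

open Filter MeasureTheory Topology
namespace MBLB
open scoped ComplexOrder BoundedContinuousFunction ComplexConjugate

/-- synonym of `BF` carrying the semi-inner product -/
def Pre (_M : BF →ₗ[ℂ] ℂ) := BF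

noncomputable instance (M : BF →ₗ[ℂ] ℂ) : AddCommGroup (Pre M) := inferInstanceAs (AddCommGroup BF)
noncomputable instance (M : BF →ₗ[ℂ] ℂ) : Module ℂ (Pre M) := inferInstanceAs (Module ℂ BF)

lemma IsPos.sq_nonneg {M : BF →ₗ[ℂ] ℂ} (hM : IsPos M) (f : BF) : 0 ≤ M (star f * f) :=
  hM _ (fun n => by
    have := star_mul_self_nonneg (f n)
    simpa using this)

/-- the semi-inner product -/
@[reducible] noncomputable def preCore (M : BF →ₗ[ℂ] ℂ) (hM : IsPos M) : PreInnerProductSpace.Core ℂ (Pre M) where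
  inner f g := M (star (show BF from f) * (show BF from g))
  conj_inner_symm f g := by
    change conj (M (star (show BF from g) * (show BF from f))) = M (star (show BF from f) * (show BF from g))
    rw [← hM.map_star, star_mul, star_star]
  re_inner_nonneg f := (Complex.le_def.1 (hM.sq_nonneg _)).1
  add_left f g h := by
    change M (star ((show BF from f) + (show BF from g)) * (show BF from h)) =
      M (star (show BF from f) * (show BF from h)) + M (star (show BF from g) * (show BF from h))
    rw [← map_add, star_add, add_mul]
  smul_left f g r := by
    change M (star (r • (show BF from f)) * (show BF from g)) =
      conj r * M (star (show BF from f) * (show BF from g))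
    rw [star_smul, smul_mul_assoc, map_smul]; rfl

theorem gns (M : BF →ₗ[ℂ] ℂ) (hM : IsPos M) : ∃ (H : Type) (_ : NormedAddCommGroup H)
    (_ : InnerProductSpace ℂ H) (_ : CompleteSpace H) (ι : BF →ₗ[ℂ] H),
    DenseRange ι ∧ ∀ f g, inner ℂ (ι f) (ι g) = M (star f * g) := by
  let _ : SeminormedAddCommGroup (Pre M) :=
    InnerProductSpace.Core.toSeminormedAddCommGroup (c := preCore M hM)
  let _ : InnerProductSpace ℂ (Pre M) := InnerProductSpace.ofCore (preCore M hM)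
  let ι : BF →ₗ[ℂ] UniformSpace.Completion (Pre M) :=
    { toFun := fun f => UniformSpace.Completion.coe' (α := Pre M) f
      map_add' := fun f g => UniformSpace.Completion.coe_add (α := Pre M) f g
      map_smul' := fun c f => UniformSpace.Completion.coe_smul (X := Pre M) c f }
  refine ⟨UniformSpace.Completion (Pre M), inferInstance, inferInstance, inferInstance, ι,
    UniformSpace.Completion.denseRange_coe (α := Pre M), fun f g => ?_⟩
  exact UniformSpace.Completion.inner_coe (E := Pre M) f g

section ext
variable {M : BF →ₗ[ℂ] ℂ} {H : Type} [NormedAddCommGroup H] [InnerProductSpace ℂ H] [CompleteSpace H]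
  {ι : BF →ₗ[ℂ] H} (hd : DenseRange ι) (hi : ∀ f g, inner ℂ (ι f) (ι g) = M (star f * g))
include hd hi

omit [CompleteSpace H] hd in
lemma norm_sq_iota (f : BF) : ((‖ι f‖ ^ 2 : ℝ) : ℂ) = M (star f * f) := by
  rw [← hi, inner_self_eq_norm_sq_to_K]; simp

lemma ext_isom (S : BF →ₗ[ℂ] BF) (hS : ∀ f, M (star (S f) * S f) = M (star f * f)) :
    ∃ T : H →ₗᵢ[ℂ] H, ∀ f, T (ι f) = ι (S f) := by
  have hn : ∀ f, ‖ι (S f)‖ = ‖ι f‖ := fun f => by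
    have h1 := norm_sq_iota hi (S f)
    rw [hS, ← norm_sq_iota hi f] at h1
    have h2 : ‖ι (S f)‖ ^ 2 = ‖ι f‖ ^ 2 := by exact_mod_cast h1
    exact (sq_eq_sq₀ (norm_nonneg _) (norm_nonneg _)).1 h2
  have hb : ∃ C, ∀ f, ‖(ι ∘ₗ S) f‖ ≤ C * ‖ι f‖ := ⟨1, fun f => by simp [hn]⟩
  have he := LinearMap.extendOfNorm_eq hd hb
  set T := (ι ∘ₗ S).extendOfNorm ι
  refine ⟨⟨T.toLinearMap, fun x => ?_⟩, fun f => he f⟩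
  refine hd.induction_on (p := fun x => ‖T x‖ = ‖x‖) x ?_ ?_
  · exact isClosed_eq (by fun_prop) (by fun_prop)
  · intro f; rw [he]; exact hn f

end ext

/-- right shift -/
noncomputable def rsh (f : BF) : BF := bf (fun n => if n = 0 then 0 else f (n - 1)) ‖f‖ (fun n => by
  split_ifs
  · simp
  · exact f.norm_coe_le_norm _)

lemma sh_rsh (f : BF) : sh (rsh f) = f := by ext n; simp [rsh]

/-- the data attached to a mean -/
structure Sys (M : BF →ₗ[ℂ] ℂ) (H : Type) [NormedAddCommGroup H] [InnerProductSpace ℂ H]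
    (ι : BF →ₗ[ℂ] H) (T : H →ₗᵢ[ℂ] H) (X : Circle → H →ₗᵢ[ℂ] H) : Prop where
  mean : IsMean M
  dense : DenseRange ι
  inner_eq : ∀ f g, inner ℂ (ι f) (ι g) = M (star f * g)
  T_eq : ∀ f, T (ι f) = ι (sh f)
  T_surj : Function.Surjective T
  X_eq : ∀ z f, X z (ι f) = ι (ch z * f)

theorem exists_sys (M : BF →ₗ[ℂ] ℂ) (hM : IsMean M) : ∃ (H : Type) (_ : NormedAddCommGroup H)
    (_ : InnerProductSpace ℂ H) (_ : CompleteSpace H) (ι : BF →ₗ[ℂ] H) (T : H →ₗᵢ[ℂ] H)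
    (X : Circle → H →ₗᵢ[ℂ] H), Sys M H ι T X := by
  obtain ⟨H, i1, i2, i3, ι, hd, hi⟩ := gns M hM.isPos
  obtain ⟨T, hT⟩ := ext_isom hd hi sh (fun f => by
    rw [← hM.shift (star f * f)]; rfl)
  have hX : ∀ z : Circle, ∃ X : H →ₗᵢ[ℂ] H, ∀ f, X (ι f) = ι (ch z * f) := fun z => by
    refine ext_isom hd hi (LinearMap.mulLeft ℂ (ch z)) (fun f => ?_)
    congr 1
    rw [LinearMap.mulLeft_apply, star_mul, ch_star]
    calc star f * ch z⁻¹ * (ch z * f) = (ch z⁻¹ * ch z) * (star f * f) := by ring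
      _ = _ := by rw [ch_mul, inv_mul_cancel, ch_one, one_mul]
  choose X hX using hX
  refine ⟨H, i1, i2, i3, ι, T, X, hM, hd, hi, hT, ?_, hX⟩
  have h1 : IsClosed (Set.range T) := T.isometry.isClosedEmbedding.isClosed_range
  have h2 : Dense (Set.range T) := by
    refine hd.mono ?_
    rintro _ ⟨f, rfl⟩
    exact ⟨ι (rsh f), by rw [hT, sh_rsh]⟩
  rw [← Set.range_eq_univ, ← h1.closure_eq]
  exact h2.closure_eq

end MBLB

open Filter MeasureTheory Topology
namespace MBLB
open scoped ComplexOrder BoundedContinuousFunction ComplexConjugate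

lemma ultralim {X V : Type*} [AddCommGroup V] [Module ℂ V] (𝒰 : Ultrafilter X)
    (L : X → V →ₗ[ℂ] ℂ) (C : V → ℝ) (h : ∀ x f, ‖L x f‖ ≤ C f) :
    ∃ L' : V →ₗ[ℂ] ℂ, ∀ f, Tendsto (fun x => L x f) 𝒰 (𝓝 (L' f)) := by
  have h1 : ∀ f, ∃ l : ℂ, Tendsto (fun x => L x f) 𝒰 (𝓝 l) := fun f => by
    obtain ⟨l, -, hl⟩ := (isCompact_closedBall (0 : ℂ) (C f)).ultrafilter_le_nhds
      (𝒰.map (fun x => L x f)) (by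
        rw [le_principal_iff]
        refine Ultrafilter.mem_map.2 ?_
        refine Filter.univ_mem' fun x => ?_
        simpa using h x f)
    exact ⟨l, hl⟩
  choose l hl using h1
  refine ⟨⟨⟨l, fun f g => ?_⟩, fun c f => ?_⟩, hl⟩
  · have := (hl f).add (hl g)
    simp only [← map_add] at this
    exact tendsto_nhds_unique (hl _) this
  · have := (hl f).const_mul c
    simp only [← smul_eq_mul, ← map_smul] at this
    exact tendsto_nhds_unique (hl _) this

open Classical in
/-- indicator -/
noncomputable def ind (D : Set ℕ) : BF := bf (fun n => if n ∈ D then 1 else 0) 1 (fun n => by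
  split_ifs <;> simp)

open Classical in
lemma ind_apply (D : Set ℕ) (n : ℕ) : ind D n = if n ∈ D then 1 else 0 := rfl

/-- dilation -/
noncomputable def dil (p q : ℕ) : BF →ₗ[ℂ] BF where
  toFun f := bf (fun n => f (p * n + q)) ‖f‖ (fun n => f.norm_coe_le_norm _)
  map_add' f g := by ext n; simp
  map_smul' c f := by ext n; simp

@[simp] lemma dil_apply (p q : ℕ) (f : BF) (n : ℕ) : dil p q f n = f (p * n + q) := rfl

/-- average of dilations -/
noncomputable def avd (p : ℕ) (f : BF) : BF := (p : ℂ)⁻¹ • ∑ j ∈ Finset.range p, dil p j f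

/-- Cesaro averages -/
noncomputable def ces (N : ℕ) : BF →ₗ[ℂ] ℂ where
  toFun f := (N : ℂ)⁻¹ * ∑ b ∈ Finset.range N, f b
  map_add' f g := by simp [Finset.sum_add_distrib, mul_add]
  map_smul' c f := by simp [← Finset.mul_sum]; ring

lemma ces_apply (N : ℕ) (f : BF) : ces N f = (N : ℂ)⁻¹ * ∑ b ∈ Finset.range N, f b := rfl

lemma ces_norm (N : ℕ) (f : BF) : ‖ces N f‖ ≤ ‖f‖ := by
  rw [ces_apply, norm_mul, norm_inv, Complex.norm_natCast]
  rcases Nat.eq_zero_or_pos N with rfl | hN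
  · simp
  have : ‖∑ b ∈ Finset.range N, f b‖ ≤ N * ‖f‖ := by
    simpa using norm_sum_le_of_le (Finset.range N) (fun b _ => f.norm_coe_le_norm b)
  have hN' : (0 : ℝ) < N := by exact_mod_cast hN
  rw [inv_mul_le_iff₀ hN']
  exact this

lemma sum_dil (f : ℕ → ℂ) (p N : ℕ) :
    ∑ b ∈ Finset.range N, ∑ j ∈ Finset.range p, f (p * b + j) = ∑ n ∈ Finset.range (p * N), f n := by
  induction N with
  | zero => simp
  | succ N ih => rw [Finset.sum_range_succ, ih, mul_add, mul_one, Finset.sum_range_add]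

lemma ces_avd (p : ℕ) (N : ℕ) (f : BF) : ces N (avd p f) = ces (p * N) f := by
  have h : ∀ b, avd p f b = (p : ℂ)⁻¹ * ∑ j ∈ Finset.range p, f (p * b + j) := fun b => by
    simp [avd, BoundedContinuousFunction.coe_sum]
  rw [ces_apply, ces_apply, ← sum_dil]
  simp_rw [h, ← Finset.mul_sum]
  push_cast
  rw [mul_inv]; ring

theorem exists_mean0 (A : Set ℕ) (c : ℝ)
    (hc : ∀ᶠ n in atTop, c ≤ (ces n (ind A)).re) (p q : ℕ) (hp : 0 < p) (hq : 0 < q) :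
    ∃ M : BF →ₗ[ℂ] ℂ, IsMean M ∧ 2 * c ≤ (M (avd p (ind A) + avd q (ind A))).re := by
  obtain ⟨M, hM⟩ := ultralim (Ultrafilter.of (atTop : Filter ℕ)) ces (fun f => ‖f‖) ces_norm
  have hle : ((Ultrafilter.of (atTop : Filter ℕ)) : Filter ℕ) ≤ atTop := Ultrafilter.of_le _
  refine ⟨M, ⟨fun f hf => ?_, ?_, fun f => ?_⟩, ?_⟩
  · refine ge_of_tendsto' (hM f) (fun N => ?_)
    rw [ces_apply]
    exact mul_nonneg (by positivity) (Finset.sum_nonneg fun b _ => hf b)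
  · refine tendsto_nhds_unique (hM 1) (tendsto_const_nhds.congr' ?_)
    filter_upwards [hle (eventually_gt_atTop 0)] with N hN
    have : (N : ℂ) ≠ 0 := by exact_mod_cast hN.ne'
    rw [ces_apply]; simp [this]
  · have h1 := (hM (sh f)).sub (hM f)
    have h2 : Tendsto (fun N => ces N (sh f) - ces N f) atTop (𝓝 0) := by
      have h3 : ∀ N, ‖ces N (sh f) - ces N f‖ ≤ (2 * ‖f‖) * (N : ℝ)⁻¹ := fun N => by
        have : ces N (sh f) - ces N f = (N : ℂ)⁻¹ * (f N - f 0) := by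
          rw [ces_apply, ces_apply, ← mul_sub, ← Finset.sum_sub_distrib]
          congr 1
          exact Finset.sum_range_sub f N
        rw [this, norm_mul, norm_inv, Complex.norm_natCast, mul_comm]
        gcongr
        have := norm_sub_le (f N) (f 0)
        have := f.norm_coe_le_norm N
        have := f.norm_coe_le_norm 0
        linarith
      refine squeeze_zero_norm h3 ?_
      simpa using (tendsto_inv_atTop_nhds_zero_nat (𝕜 := ℝ)).const_mul (2 * ‖f‖)
    exact sub_eq_zero.1 (tendsto_nhds_unique h1 (h2.mono_left hle))
  · have h1 := (Complex.continuous_re.tendsto _).comp (hM (avd p (ind A) + avd q (ind A)))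
    refine ge_of_tendsto h1 ?_
    have e : ∀ p : ℕ, 0 < p → ∀ᶠ N in atTop, c ≤ (ces (p * N) (ind A)).re := fun p hp =>
      (tendsto_id.const_mul_atTop' hp).eventually hc
    filter_upwards [hle (e p hp), hle (e q hq)] with N h1 h2
    simp only [Function.comp, map_add, ces_avd, Complex.add_re]
    linarith

/-- extremality -/
def Ext (M : BF →ₗ[ℂ] ℂ) : Prop := ∀ L : BF →ₗ[ℂ] ℂ, IsMean (M + L) → IsMean (M - L) → L = 0

theorem exists_ext (φ : BF) (c : ℝ) (M : BF →ₗ[ℂ] ℂ) (hM : IsMean M) (h : c < (M φ).re) :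
    ∃ M' : BF →ₗ[ℂ] ℂ, IsMean M' ∧ Ext M' ∧ c < (M' φ).re := by
  let S : Set (BF → ℂ) := {u | ∃ M : BF →ₗ[ℂ] ℂ, IsMean M ∧ ⇑M = u}
  have hS : S = {u | (∀ f g, u (f + g) = u f + u g) ∧ (∀ (c : ℂ) f, u (c • f) = c * u f) ∧
      (∀ f : BF, (∀ n, 0 ≤ f n) → 0 ≤ u f) ∧ u 1 = 1 ∧ ∀ f, u (sh f) = u f} := by
    ext u
    constructor
    · rintro ⟨M, hM, rfl⟩
      exact ⟨map_add M, fun c f => by simp, hM.pos, hM.one, hM.shift⟩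
    · rintro ⟨h1, h2, h3, h4, h5⟩
      exact ⟨⟨⟨u, h1⟩, h2⟩, ⟨h3, h4, h5⟩, rfl⟩
  have hcl : IsClosed S := by
    rw [hS]
    simp only [Set.ofPred_and, Set.ofPred_forall]
    refine IsClosed.inter ?_ (IsClosed.inter ?_ (IsClosed.inter ?_ (IsClosed.inter ?_ ?_)))
    · exact isClosed_iInter fun f => isClosed_iInter fun g => isClosed_eq (by fun_prop) (by fun_prop)
    · exact isClosed_iInter fun f => isClosed_iInter fun g => isClosed_eq (by fun_prop) (by fun_prop)
    · exact isClosed_iInter fun f => isClosed_iInter fun g => isClosed_le (by fun_prop) (by fun_prop)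
    · exact isClosed_eq (by fun_prop) (by fun_prop)
    · exact isClosed_iInter fun f => isClosed_eq (by fun_prop) (by fun_prop)
  have hcomp : IsCompact S := by
    refine (isCompact_univ_pi (fun f : BF => isCompact_closedBall (0 : ℂ) ‖f‖)).of_isClosed_subset hcl ?_
    rintro u ⟨M, hM, rfl⟩ f -
    simpa using hM.norm_le_norm f
  have hconv : Convex ℝ S := by
    rintro _ ⟨M1, h1, rfl⟩ _ ⟨M2, h2, rfl⟩ a b ha hb hab
    refine ⟨(a : ℂ) • M1 + (b : ℂ) • M2, ⟨fun f hf => ?_, ?_, fun f => ?_⟩, ?_⟩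
    · have := h1.pos f hf
      have := h2.pos f hf
      have ha' : (0 : ℂ) ≤ a := by exact_mod_cast ha
      have hb' : (0 : ℂ) ≤ b := by exact_mod_cast hb
      simp only [LinearMap.add_apply, LinearMap.smul_apply, smul_eq_mul]
      positivity
    · simp [h1.one, h2.one]; exact_mod_cast hab
    · simp [h1.shift, h2.shift]
    · ext f; simp
  by_contra hcon
  push Not at hcon
  have hKM := closure_convexHull_extremePoints hcomp hconv
  have hsub : closure (convexHull ℝ (S.extremePoints ℝ)) ⊆ {u | (u φ).re ≤ c} := by
    refine closure_minimal (convexHull_min ?_ ?_) ?_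
    · rintro u ⟨⟨M1, h1, rfl⟩, hu2⟩
      refine hcon M1 h1 ?_
      intro L hp hm
      have := hu2 ⟨M1 + L, hp, rfl⟩ ⟨M1 - L, hm, rfl⟩ ⟨1/2, 1/2, by norm_num, by norm_num, by norm_num, by
        ext f; simp; ring⟩
      ext1 f
      have h3 := congrFun this f
      simpa using h3
    · intro x hx y hy a b ha hb hab
      simp only [Set.mem_ofPred_eq, Pi.add_apply, Pi.smul_apply, Complex.add_re, Complex.smul_re, smul_eq_mul] at hx hy ⊢
      calc a * (x φ).re + b * (y φ).re ≤ a * c + b * c := by gcongr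
        _ = c := by rw [← add_mul, hab, one_mul]
    · exact isClosed_le (by fun_prop) (by fun_prop)
  rw [hKM] at hsub
  exact absurd (hsub ⟨M, hM, rfl⟩) (by simpa using h)

end MBLB

open Filter MeasureTheory Topology
namespace MBLB
open scoped ComplexOrder BoundedContinuousFunction ComplexConjugate

section
variable {M : BF →ₗ[ℂ] ℂ} {H : Type} [NormedAddCommGroup H] [InnerProductSpace ℂ H] [CompleteSpace H]
  {ι : BF →ₗ[ℂ] H} {T : H →ₗᵢ[ℂ] H} {X : Circle → H →ₗᵢ[ℂ] H}

lemma re_in (f : BF) (hf : ∀ n, (f n).im = 0) (n : ℕ) : f n = ((f n).re : ℂ) := by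
  apply Complex.ext <;> simp [hf]

/-- ergodic averages of `f` -/
noncomputable def avg (N : ℕ) (f : BF) : BF := (N : ℂ)⁻¹ • ∑ k ∈ Finset.range N, (sh ^ k) f

lemma avg_real (N : ℕ) (f : BF) (hf : ∀ n, (f n).im = 0) (h1 : ∀ n, ‖f n‖ ≤ 1) (n : ℕ) :
    ∃ r : ℝ, |r| ≤ 1 ∧ avg N f n = r := by
  have e : avg N f n = (((N : ℝ)⁻¹ * ∑ k ∈ Finset.range N, (f (n + k)).re : ℝ) : ℂ) := by
    simp only [avg, BoundedContinuousFunction.coe_smul, BoundedContinuousFunction.coe_sum, Finset.sum_apply,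
      sh_pow_apply, smul_eq_mul]
    push_cast
    congr 1
    exact Finset.sum_congr rfl fun k _ => re_in f hf _
  refine ⟨_, ?_, e⟩
  rw [abs_mul, abs_inv, Nat.abs_cast]
  rcases Nat.eq_zero_or_pos N with rfl | hN
  · simp
  have hN' : (0 : ℝ) < N := by exact_mod_cast hN
  rw [inv_mul_le_iff₀ hN']
  refine (Finset.abs_sum_le_sum_abs _ _).trans ?_
  refine (Finset.sum_le_card_nsmul _ _ 1 fun k _ => (Complex.abs_re_le_norm _).trans (h1 _)).trans ?_
  simp

omit [CompleteSpace H] in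
lemma Sys.T_pow (hs : Sys M H ι T X) (k : ℕ) (f : BF) : T^[k] (ι f) = ι ((sh ^ k) f) := by
  induction k with
  | zero => simp
  | succ k ih => rw [Function.iterate_succ_apply', ih, hs.T_eq, pow_succ', Module.End.mul_apply]

lemma Sys.claimA (hs : Sys M H ι T X) (hE : Ext M) (f : BF) (hf : ∀ n, (f n).im = 0)
    (h1 : ∀ n, ‖f n‖ ≤ 1) (hM0 : M f = 0) (v : H) (hv : T v = v) : inner ℂ v (ι f) = 0 := by
  set Tc : H →L[ℂ] H := T.toContinuousLinearMap with hTc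
  set K := Tc.eqLocus (1 : H →L[ℂ] H) with hK
  have hlim := Tc.tendsto_birkhoffAverage_orthogonalProjection T.norm_toContinuousLinearMap_le (ι f)
  have memK : ∀ x : H, x ∈ K ↔ T x = x := fun x => Iff.rfl
  set w : K := K.orthogonalProjectionOnto (ι f) with hw
  have hproj : ∀ x : H, x ∈ K → inner ℂ x (ι f) = inner ℂ x (w : H) := fun x hx => by
    have := K.inner_orthogonalProjectionOnto_eq_of_mem_left ⟨x, hx⟩ (ι f)
    exact this.symm
  have hav : ∀ N, birkhoffAverage ℂ Tc _root_.id N (ι f) = ι (avg N f) := fun N => by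
    rw [birkhoffAverage, birkhoffSum, avg, map_smul, map_sum]
    congr 1
    refine Finset.sum_congr rfl fun k _ => ?_
    exact hs.T_pow k f
  let L : BF →ₗ[ℂ] ℂ := (innerSL ℂ (w : H)).toLinearMap ∘ₗ ι
  have hL : ∀ g, L g = inner ℂ (w : H) (ι g) := fun g => rfl
  have hLlim : ∀ g, Tendsto (fun N => M (star (avg N f) * g)) atTop (𝓝 (L g)) := fun g => by
    have : Tendsto (fun N => inner ℂ (birkhoffAverage ℂ Tc _root_.id N (ι f)) (ι g)) atTop (𝓝 (L g)) :=
      hlim.inner tendsto_const_nhds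
    simpa only [hav, hs.inner_eq] using this
  have hLone : L 1 = 0 := by
    have h2 : inner ℂ (ι 1) (w : H) = 0 := by
      rw [← hproj _ ((memK _).2 (by rw [hs.T_eq]; rfl)), hs.inner_eq]
      simpa using hM0
    rw [hL, ← inner_conj_symm, h2]; simp
  have hLsh : ∀ g, L (sh g) = L g := fun g => by
    rw [hL, hL, ← hs.T_eq]
    conv_lhs => rw [← (memK _).1 w.2]
    rw [T.inner_map_map]
  have hz : L = 0 := by
    refine hE L ⟨fun g hg => ?_, ?_, fun g => ?_⟩ ⟨fun g hg => ?_, ?_, fun g => ?_⟩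
    · refine ge_of_tendsto' ((hLlim g).const_add (M g)) fun N => ?_
      rw [← map_add]
      refine hs.mean.pos _ fun n => ?_
      obtain ⟨r, hr, he⟩ := avg_real N f hf h1 n
      have : (g + star (avg N f) * g) n = ((1 + r : ℝ) : ℂ) * g n := by
        simp [he]; ring
      rw [this]
      have hr2 : (0 : ℂ) ≤ ((1 + r : ℝ) : ℂ) := by
        exact_mod_cast (by linarith [neg_le_of_abs_le hr] : (0:ℝ) ≤ 1 + r)
      exact mul_nonneg hr2 (hg n)
    · simp [hLone, hs.mean.one]
    · simp [hLsh, hs.mean.shift]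
    · refine ge_of_tendsto' ((hLlim g).const_sub (M g)) fun N => ?_
      rw [← map_sub]
      refine hs.mean.pos _ fun n => ?_
      obtain ⟨r, hr, he⟩ := avg_real N f hf h1 n
      have : (g - star (avg N f) * g) n = ((1 - r : ℝ) : ℂ) * g n := by
        simp [he]; ring
      rw [this]
      have hr2 : (0 : ℂ) ≤ ((1 - r : ℝ) : ℂ) := by
        exact_mod_cast (by linarith [le_of_abs_le hr] : (0:ℝ) ≤ 1 - r)
      exact mul_nonneg hr2 (hg n)
    · simp [hLone, hs.mean.one]
    · simp [hLsh, hs.mean.shift]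
  have h3 : inner ℂ (w : H) (w : H) = 0 := by
    rw [← hproj _ w.2, ← hL, hz]; rfl
  rw [hproj v ((memK v).2 hv), inner_self_eq_zero.1 h3, inner_zero_right]

lemma Sys.claimA' (hs : Sys M H ι T X) (hE : Ext M) (f : BF) (hf : ∀ n, (f n).im = 0)
    (hM0 : M f = 0) (v : H) (hv : T v = v) : inner ℂ v (ι f) = 0 := by
  have hpos : (0 : ℝ) < ‖f‖ + 1 := by positivity
  have h := hs.claimA hE ((((‖f‖ + 1)⁻¹ : ℝ) : ℂ) • f) (fun n => by simp [hf]) (fun n => by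
    rw [BoundedContinuousFunction.coe_smul, norm_smul, Complex.norm_real, norm_inv, Real.norm_of_nonneg hpos.le, inv_mul_le_iff₀ hpos]
    linarith [f.norm_coe_le_norm n]) (by simp [hM0]) v hv
  rw [map_smul, inner_smul_right] at h
  rcases mul_eq_zero.1 h with h | h
  · exfalso
    have : (‖f‖ + 1)⁻¹ = 0 := by exact_mod_cast h
    have := inv_pos.2 hpos
    linarith
  · exact h

lemma Sys.claimB (hs : Sys M H ι T X) (hE : Ext M) (f : BF)
    (hM0 : M f = 0) (v : H) (hv : T v = v) : inner ℂ v (ι f) = 0 := by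
  have hst : M (star f) = 0 := by rw [hs.mean.isPos.map_star, hM0]; simp
  have h1 := hs.claimA' hE (f + star f) (fun n => by simp) (by simp [hM0, hst]) v hv
  have h2 := hs.claimA' hE (Complex.I • (f - star f)) (fun n => by simp) (by simp [hM0, hst]) v hv
  rw [map_add, inner_add_right] at h1
  rw [map_smul, inner_smul_right, map_sub, inner_sub_right] at h2
  have h3 : inner ℂ v (ι f) - inner ℂ v (ι (star f)) = 0 := by
    rcases mul_eq_zero.1 h2 with h | h
    · exact absurd h Complex.I_ne_zero
    · exact h
  linear_combination (h1 + h3) / 2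

lemma Sys.erg (hs : Sys M H ι T X) (hE : Ext M) (v : H) (hv : T v = v) :
    v = (inner ℂ (ι 1) v : ℂ) • ι 1 := by
  refine ext_inner_right ℂ fun x => ?_
  refine hs.dense.induction_on (p := fun x => inner ℂ v x = inner ℂ ((inner ℂ (ι 1) v : ℂ) • ι 1) x) x ?_ ?_
  · exact isClosed_eq (by fun_prop) (by fun_prop)
  · intro f
    have h := hs.claimB hE (f - M f • 1) (by simp [hs.mean.one]) v hv
    rw [map_sub, inner_sub_right, map_smul, inner_smul_right, sub_eq_zero] at h
    rw [h, inner_smul_left, inner_conj_symm, hs.inner_eq 1 f]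
    simp [mul_comm]

omit [CompleteSpace H] in
lemma Sys.X_inv (hs : Sys M H ι T X) (z : Circle) (v : H) : X z (X z⁻¹ v) = v := by
  refine hs.dense.induction_on (p := fun v => X z (X z⁻¹ v) = v) v ?_ ?_
  · exact isClosed_eq (by fun_prop) (by fun_prop)
  · intro f
    rw [hs.X_eq, hs.X_eq, ← mul_assoc, ch_mul, mul_inv_cancel, ch_one, one_mul]

lemma sh_mul (f g : BF) : sh (f * g) = sh f * sh g := rfl

omit [CompleteSpace H] in
lemma Sys.T_X (hs : Sys M H ι T X) (z : Circle) (v : H) : T (X z v) = (z : ℂ) • X z (T v) := by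
  refine hs.dense.induction_on (p := fun v => T (X z v) = (z : ℂ) • X z (T v)) v ?_ ?_
  · exact isClosed_eq (by fun_prop) (by fun_prop)
  · intro f
    rw [hs.X_eq, hs.T_eq, hs.T_eq, hs.X_eq, sh_mul, sh_ch, smul_mul_assoc, map_smul]

lemma Sys.no_eig (hs : Sys M H ι T X) (hE : Ext M) (v : H) (c : ℂ) (hv : T v = c • v)
    (ho : ∀ z, inner ℂ (ι (ch z)) v = 0) : v = 0 := by
  by_contra hv0
  have hc : ‖c‖ = 1 := by
    have h1 := T.norm_map v
    rw [hv, norm_smul] at h1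
    have : ‖v‖ ≠ 0 := by simpa using hv0
    exact mul_right_cancel₀ this (by rw [h1, one_mul])
  obtain ⟨z, hz⟩ : ∃ z : Circle, (z : ℂ) = c := ⟨⟨c, by simpa [Submonoid.unitSphere] using hc⟩, rfl⟩
  have hfix : T (X z⁻¹ v) = X z⁻¹ v := by
    rw [hs.T_X, hv, map_smul, smul_smul, ← hz, ← Circle.coe_mul, inv_mul_cancel, Circle.coe_one, one_smul]
  have h1 := hs.erg hE _ hfix
  have h2 : inner ℂ (ι 1) (X z⁻¹ v) = 0 := by
    rw [← (X z).inner_map_map, hs.X_inv, hs.X_eq, mul_one]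
    exact ho z
  rw [h2, zero_smul] at h1
  have h3 := hs.X_inv z v
  rw [h1, map_zero] at h3
  exact hv0 h3.symm

end
end MBLB

open Filter MeasureTheory Topology
namespace MBLB
open scoped ComplexOrder BoundedContinuousFunction ComplexConjugate

lemma IsMean.norm_sq_le {M : BF →ₗ[ℂ] ℂ} (hM : IsMean M) (f : BF) :
    ‖M f‖ ^ 2 ≤ (M (star f * f)).re := by
  have h := hM.isPos.sq_nonneg (f - M f • 1)
  have e : star (f - M f • (1 : BF)) * (f - M f • 1) =
      star f * f - M f • star f - (conj (M f)) • f + (conj (M f) * M f) • 1 := by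
    ext n; simp; ring
  rw [e] at h
  simp only [map_add, map_sub, map_smul, hM.isPos.map_star, hM.one, smul_eq_mul] at h
  have h2 := (Complex.le_def.1 h).1
  have e2 : (M (star f * f) - M f * conj (M f) - conj (M f) * M f + conj (M f) * M f * 1) =
    M (star f * f) - (((‖M f‖) ^ 2 : ℝ) : ℂ) := by
    rw [Complex.mul_conj, Complex.normSq_eq_norm_sq]; ring
  rw [e2] at h2
  simp only [Complex.zero_re, Complex.sub_re, Complex.ofReal_re] at h2
  linarith

/-- absolute value -/
noncomputable def absB (f : BF) : BF := bf (fun n => (‖f n‖ : ℂ)) ‖f‖ (fun n => by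
  simpa using f.norm_coe_le_norm n)

lemma absB_apply (f : BF) (n : ℕ) : absB f n = (‖f n‖ : ℂ) := rfl

lemma absB_sq (f : BF) : star (absB f) * absB f = star f * f := by
  ext n
  simp only [BoundedContinuousFunction.coe_mul, Pi.mul_apply, BoundedContinuousFunction.star_apply, absB_apply]
  rw [← starRingEnd_apply, ← starRingEnd_apply, Complex.conj_mul', Complex.conj_mul']
  simp

lemma IsMean.abs_le {M : BF →ₗ[ℂ] ℂ} (hM : IsMean M) (f : BF) :
    ‖M (absB f)‖ ^ 2 ≤ (M (star f * f)).re := by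
  rw [← absB_sq]; exact hM.norm_sq_le _

section W
variable {H : Type} [NormedAddCommGroup H] [InnerProductSpace ℂ H]

lemma small_off (q : H → ℝ) (hq : ∀ (c : ℂ) v, q (c • v) = ‖c‖ ^ 2 * q v) (C : ℝ)
    (ht : ∀ (n : ℕ) (v : Fin n → H), Orthonormal ℂ v → ∑ i, q (v i) ≤ C) (ε : ℝ) (hε : 0 < ε) :
    ∃ V : Submodule ℂ H, FiniteDimensional ℂ V ∧ ∀ v ∈ Vᗮ, q v ≤ ε * ‖v‖ ^ 2 := by
  by_contra hcon
  push Not at hcon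
  have key : ∀ n : ℕ, ∃ v : Fin n → H, Orthonormal ℂ v ∧ ∀ i, ε ≤ q (v i) := by
    intro n
    induction n with
    | zero => exact ⟨Fin.elim0, ⟨fun i => i.elim0, fun i => i.elim0⟩, fun i => i.elim0⟩
    | succ n ih =>
      obtain ⟨v, hv, hvq⟩ := ih
      obtain ⟨u, hu, huq⟩ := hcon (Submodule.span ℂ (Set.range v))
        (FiniteDimensional.span_of_finite ℂ (Set.finite_range v))
      have hu0 : u ≠ 0 := by
        rintro rfl
        have := hq 0 0
        simp at this
        simp [this] at huq
      have hun : ‖u‖ ≠ 0 := by simpa using hu0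
      have hun' : (‖u‖ : ℂ) ≠ 0 := by exact_mod_cast hun
      have hup : 0 < ‖u‖ := norm_pos_iff.2 hu0
      have ho : ∀ i, inner ℂ (v i) u = 0 := fun i =>
        (Submodule.mem_orthogonal _ _).1 hu _ (Submodule.subset_span ⟨i, rfl⟩)
      have ho' : ∀ i, inner ℂ u (v i) = 0 := fun i => inner_eq_zero_symm.1 (ho i)
      refine ⟨Fin.cons ((‖u‖⁻¹ : ℂ) • u) v, ?_, ?_⟩
      · rw [orthonormal_iff_ite] at hv ⊢
        intro i j
        refine Fin.cases ?_ (fun i => ?_) i <;> refine Fin.cases ?_ (fun j => ?_) j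
        · simp only [Fin.cons_zero, if_true]
          rw [inner_smul_left, inner_smul_right, inner_self_eq_norm_sq_to_K]
          simp
          field_simp
        · simp only [Fin.cons_zero, Fin.cons_succ]
          rw [inner_smul_left, ho', if_neg (Fin.succ_ne_zero j).symm, mul_zero]
        · simp only [Fin.cons_zero, Fin.cons_succ]
          rw [inner_smul_right, ho, if_neg (Fin.succ_ne_zero i), mul_zero]
        · simp only [Fin.cons_succ, hv i j, Fin.succ_inj]
      · intro i
        refine Fin.cases ?_ (fun i => ?_) i
        · simp only [Fin.cons_zero, hq, norm_inv, Complex.norm_real, norm_norm, inv_pow]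
          rw [le_inv_mul_iff₀ (by positivity)]
          linarith
        · simpa using hvq i
  obtain ⟨n, hn⟩ := exists_nat_gt (C / ε)
  obtain ⟨v, hv, hvq⟩ := key n
  have h1 := ht n v hv
  have h2 : n * ε ≤ ∑ i, q (v i) := by
    have := Finset.card_nsmul_le_sum Finset.univ (fun i => q (v i)) ε (fun i _ => hvq i)
    simpa using this
  rw [div_lt_iff₀ hε] at hn
  linarith

/-- coefficient sequences -/
noncomputable def cf (x : ℕ → H) (C : ℝ) (hx : ∀ b, ‖x b‖ ≤ C) : H →ₗ[ℂ] BF where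
  toFun g := bf (fun b => inner ℂ (x b) g) (C * ‖g‖) (fun b =>
    (norm_inner_le_norm _ _).trans (by gcongr; exact hx b))
  map_add' f g := by ext n; simp [inner_add_right]
  map_smul' c f := by ext n; simp [inner_smul_right]

@[simp] lemma cf_apply (x : ℕ → H) (C : ℝ) (hx : ∀ b, ‖x b‖ ≤ C) (g : H) (b : ℕ) :
    cf x C hx g b = inner ℂ (x b) g := rfl

variable [CompleteSpace H]

theorem lemmaW {M : BF →ₗ[ℂ] ℂ} (hM : IsMean M) (U : H →ₗᵢ[ℂ] H) (hU : Function.Surjective U)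
    (hne : ∀ (v : H) (c : ℂ), U v = c • v → v = 0) (x : ℕ → H) (C : ℝ) (hx : ∀ b, ‖x b‖ ≤ C)
    (ℓ : ℕ) (c : ℂ) (hc : ‖c‖ = 1) (hxU : ∀ b g, inner ℂ (x (b + ℓ)) (U g) = c * inner ℂ (x b) g)
    (g : H) (f : BF) (D : ℝ) (hf : ∀ b, ‖f b‖ ≤ D * ‖(inner ℂ (x b) g : ℂ)‖) : M f = 0 := by
  have hC : 0 ≤ C := (norm_nonneg _).trans (hx 0)
  set ξ := cf x C hx with hξ
  have hB : ∀ g h, ‖M (star (ξ g) * ξ h)‖ ≤ C * ‖h‖ * ‖M (absB (ξ g))‖ := fun g h => by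
    have := hM.isPos.norm_le (star (ξ g) * ξ h) (((C * ‖h‖ : ℝ) : ℂ) • absB (ξ g)) (fun n => by
      have h1 : ‖ξ h n‖ ≤ C * ‖h‖ := (norm_inner_le_norm _ _).trans (by gcongr; exact hx n)
      simp only [BoundedContinuousFunction.coe_mul, Pi.mul_apply, BoundedContinuousFunction.star_apply,
        norm_mul, norm_star, BoundedContinuousFunction.coe_smul, absB_apply, smul_eq_mul]
      rw [← Complex.ofReal_mul, Complex.ofReal_re, mul_comm]
      gcongr)
    refine this.trans ?_
    rw [map_smul, smul_eq_mul, Complex.re_ofReal_mul]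
    gcongr
    exact Complex.re_le_norm _
  have hB1 : ∀ g, ‖M (absB (ξ g))‖ ≤ C * ‖g‖ := fun g => hM.norm_le_const _ _ (fun n => by
    rw [absB_apply, Complex.norm_real, norm_norm]
    exact (norm_inner_le_norm _ _).trans (by gcongr; exact hx n))
  let B0 : H →ₗ⋆[ℂ] H →ₗ[ℂ] ℂ := LinearMap.mk₂'ₛₗ (starRingEnd ℂ) (RingHom.id ℂ) (fun g h => M (star (ξ g) * ξ h))
    (fun g g' h => by simp [add_mul]) (fun c g h => by simp)
    (fun g h h' => by simp [mul_add]) (fun c g h => by simp)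
  let B : H →L⋆[ℂ] H →L[ℂ] ℂ := B0.mkContinuous₂ (C * C) (fun g h => by
    refine (hB g h).trans ?_
    calc _ ≤ C * ‖h‖ * (C * ‖g‖) := by gcongr; exact hB1 g
      _ = _ := by ring)
  let K := InnerProductSpace.continuousLinearMapOfBilin B
  have hK : ∀ g h, inner ℂ (K g) h = M (star (ξ g) * ξ h) := fun g h =>
    InnerProductSpace.continuousLinearMapOfBilin_apply B g h
  have hsymm : (K : H →ₗ[ℂ] H).IsSymmetric := fun g h => by
    rw [← inner_conj_symm g]
    change inner ℂ (K g) h = conj (inner ℂ (K h) g)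
    rw [hK, hK, ← hM.isPos.map_star, star_mul, star_star]
  -- trace bound
  set q : H → ℝ := fun g => (M (star (ξ g) * ξ g)).re with hqdef
  have hq : ∀ (c : ℂ) v, q (c • v) = ‖c‖ ^ 2 * q v := fun c v => by
    have : star (ξ (c • v)) * ξ (c • v) = ((‖c‖ ^ 2 : ℝ) : ℂ) • (star (ξ v) * ξ v) := by
      rw [map_smul, star_smul, smul_mul_smul_comm, Complex.star_def, Complex.conj_mul']
      simp
    simp only [hqdef]
    rw [this, map_smul, smul_eq_mul, Complex.re_ofReal_mul]
  have htr : ∀ (n : ℕ) (v : Fin n → H), Orthonormal ℂ v → ∑ i, q (v i) ≤ C ^ 2 := fun n v hv => by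
    have h1 : ∑ i, q (v i) = (M (∑ i, star (ξ (v i)) * ξ (v i))).re := by
      rw [map_sum, Complex.re_sum]
    rw [h1]
    have h2 := hM.isPos.re_mono (∑ i, star (ξ (v i)) * ξ (v i)) (((C ^ 2 : ℝ) : ℂ) • 1) (fun n => by
      have e : (∑ i, star (ξ (v i)) * ξ (v i)) n = ((∑ i, ‖(inner ℂ (v i) (x n) : ℂ)‖ ^ 2 : ℝ) : ℂ) := by
        simp only [BoundedContinuousFunction.coe_sum, Finset.sum_apply, BoundedContinuousFunction.coe_mul, Pi.mul_apply, BoundedContinuousFunction.star_apply]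
        push_cast
        refine Finset.sum_congr rfl fun i _ => ?_
        rw [Complex.star_def, Complex.conj_mul', hξ, cf_apply, norm_inner_symm]
      rw [e, Complex.ofReal_re]
      refine (hv.sum_inner_products_le (x n)).trans ?_
      have : ‖x n‖ ^ 2 ≤ C ^ 2 := by gcongr; exact hx n
      simpa [← Complex.ofReal_pow] using this)
    refine h2.trans ?_
    simp [hM.one, ← Complex.ofReal_pow]
  have hKn : ∀ u, ‖K u‖ ≤ C * ‖M (absB (ξ u))‖ := fun u => by
    by_cases h0 : ‖K u‖ = 0
    · rw [h0]; positivity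
    have h1 : ‖(inner ℂ (K u) (K u) : ℂ)‖ ≤ C * ‖K u‖ * ‖M (absB (ξ u))‖ := by
      rw [hK]; exact hB u (K u)
    rw [inner_self_eq_norm_sq_to_K] at h1
    have h2 : ‖K u‖ * ‖K u‖ ≤ (C * ‖M (absB (ξ u))‖) * ‖K u‖ := by
      simp at h1
      nlinarith
    exact le_of_mul_le_mul_right h2 (lt_of_le_of_ne (norm_nonneg _) (Ne.symm h0))
  have hcomp : IsCompactOperator K := by
    have hmem : K ∈ closure {f : H →L[ℂ] H | IsCompactOperator f} := by
      rw [Metric.mem_closure_iff]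
      intro ε hε
      obtain ⟨V, hV, hV2⟩ := small_off q hq (C ^ 2) htr ((ε / (2 * (C + 1))) ^ 2) (by positivity)
      refine ⟨K ∘L V.starProjection, ?_, ?_⟩
      · have h1 : IsCompactOperator (V.orthogonalProjectionOnto) :=
          isCompactOperator_of_locallyCompactSpace_dom _
        exact (h1.clm_comp V.subtypeL).clm_comp K
      · rw [dist_eq_norm]
        refine lt_of_le_of_lt (ContinuousLinearMap.opNorm_le_bound _ (by positivity : (0:ℝ) ≤ ε / 2) fun v => ?_) (half_lt_self hε)
        have hu : v - V.starProjection v ∈ Vᗮ := Submodule.sub_starProjection_mem_orthogonal v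
        have e : (K - K ∘L V.starProjection) v = K (v - V.starProjection v) := by simp
        rw [e]
        have hun : ‖v - V.starProjection v‖ ≤ ‖v‖ := by
          have h1 := Submodule.starProjection_orthogonal_val (K := V) (u := v)
          rw [← h1]
          exact Submodule.norm_starProjection_apply_le _ _
        set u := v - V.starProjection v
        have h3 := (hM.abs_le (ξ u)).trans (hV2 u hu)
        rw [← mul_pow] at h3
        have h4 := (sq_le_sq₀ (norm_nonneg _) (by positivity)).1 h3
        calc ‖K u‖ ≤ C * ‖M (absB (ξ u))‖ := hKn u
          _ ≤ (C + 1) * (ε / (2 * (C + 1)) * ‖v‖) := by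
            gcongr
            · linarith
            · exact h4.trans (by gcongr)
          _ = ε / 2 * ‖v‖ := by field_simp
    rwa [isClosed_setOfPred_isCompactOperator.closure_eq] at hmem
  have hcomm : ∀ g, K (U g) = U (K g) := fun g => by
    refine ext_inner_right ℂ fun y => ?_
    obtain ⟨h, rfl⟩ := hU y
    rw [U.inner_map_map, hK, hK, ← hM.shift_iter ℓ]
    congr 1
    ext b
    rw [sh_pow_apply]
    simp only [BoundedContinuousFunction.coe_mul, Pi.mul_apply, BoundedContinuousFunction.star_apply, hξ, cf_apply, hxU, star_mul]
    have : star c * c = 1 := by rw [Complex.star_def, Complex.conj_mul', hc]; simp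
    linear_combination (star (inner ℂ (x b) g) * inner ℂ (x b) h) * this
  have hK0 : K = 0 := by
    rw [← ContinuousLinearMap.eq_zero_of_forall_hasEigenvalue_eq_zero hcomp hsymm]
    intro μ hμ
    by_contra hμ0
    have hfin := ContinuousLinearMap.finite_dimensional_eigenspace hcomp μ hμ0
    set E := Module.End.eigenspace (K : H →ₗ[ℂ] H) μ with hE
    have hinv : ∀ v ∈ E, U v ∈ E := fun v hv => by
      rw [hE, Module.End.mem_eigenspace_iff] at hv ⊢
      change K (U v) = μ • U v
      rw [hcomm, ← map_smul]
      congr 1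
    have hnt : Nontrivial E := Submodule.nontrivial_iff_ne_bot.2 hμ
    obtain ⟨μ', hμ'⟩ := Module.End.exists_eigenvalue (U.toLinearMap.restrict hinv)
    obtain ⟨v, hv⟩ := hμ'.exists_hasEigenvector
    have h1 := hv.apply_eq_smul
    have h2 : U (v : H) = μ' • (v : H) := congrArg Subtype.val h1
    exact hv.2 (Subtype.ext (hne _ _ h2))
  have hz : M (absB (ξ g)) = 0 := by
    have h1 := hM.abs_le (ξ g)
    rw [← hK, hK0] at h1
    simp at h1
    exact h1
  have hfin := hM.isPos.norm_le f ((D : ℂ) • absB (ξ g)) (fun n => by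
    simp only [BoundedContinuousFunction.coe_smul, smul_eq_mul, absB_apply]
    rw [← Complex.ofReal_mul, Complex.ofReal_re]
    exact hf n)
  rw [map_smul, hz] at hfin
  simpa using hfin

end W
end MBLB

open Filter MeasureTheory Topology
namespace MBLB
open scoped ComplexOrder BoundedContinuousFunction ComplexConjugate

lemma no_eig_pow {V : Type*} [AddCommGroup V] [Module ℂ V] (T : V →ₗ[ℂ] V)
    (hT : ∀ (v : V) (c : ℂ), T v = c • v → v = 0) (m : ℕ) (hm : 0 < m) (v : V) (c : ℂ)
    (hv : (T ^ m) v = c • v) : v = 0 := by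
  by_contra hv0
  set W := Submodule.span ℂ (Set.range fun j : Fin m => (T ^ (j : ℕ)) v) with hW
  have hfin : FiniteDimensional ℂ W := FiniteDimensional.span_of_finite ℂ (Set.finite_range _)
  have hvW : v ∈ W := Submodule.subset_span ⟨⟨0, hm⟩, by simp⟩
  have hinv : ∀ u ∈ W, T u ∈ W := fun u hu => by
    induction hu using Submodule.span_induction with
    | mem u hu =>
      obtain ⟨j, rfl⟩ := hu
      change T ((T ^ (j : ℕ)) v) ∈ W
      rw [← Module.End.mul_apply, ← pow_succ']
      by_cases hj : (j : ℕ) + 1 < m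
      · exact Submodule.subset_span ⟨⟨j + 1, hj⟩, rfl⟩
      · have : (j : ℕ) + 1 = m := by omega
        rw [this, hv]
        exact W.smul_mem _ hvW
    | zero => simp
    | add x y _ _ hx hy => rw [map_add]; exact W.add_mem hx hy
    | smul a x _ hx => rw [map_smul]; exact W.smul_mem _ hx
  have hnt : Nontrivial W := ⟨⟨⟨v, hvW⟩, 0, fun h => hv0 (congrArg Subtype.val h)⟩⟩
  obtain ⟨μ', hμ'⟩ := Module.End.exists_eigenvalue (T.restrict hinv)
  obtain ⟨u, hu⟩ := hμ'.exists_hasEigenvector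
  have h2 : T (u : V) = μ' • (u : V) := congrArg Subtype.val hu.apply_eq_smul
  exact hu.2 (Subtype.ext (hT _ _ h2))

/-- the slices -/
noncomputable def Fs (ℓ m t : ℕ) (a : BF) (b : ℕ) : BF := dil ℓ (m * b + t) a

lemma Fs_apply (ℓ m t : ℕ) (a : BF) (b n : ℕ) : Fs ℓ m t a b n = a (ℓ * n + (m * b + t)) := rfl

section
variable {M : BF →ₗ[ℂ] ℂ} {H : Type} [NormedAddCommGroup H] [InnerProductSpace ℂ H]
  {ι : BF →ₗ[ℂ] H} {T : H →ₗᵢ[ℂ] H} {X : Circle → H →ₗᵢ[ℂ] H}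

lemma Sys.norm_iota_le (hs : Sys M H ι T X) (f : BF) (C : ℝ) (hC : ∀ n, ‖f n‖ ≤ C) : ‖ι f‖ ≤ C := by
  have h1 := norm_sq_iota hs.inner_eq f
  have hC0 : 0 ≤ C := (norm_nonneg _).trans (hC 0)
  have h2 := hs.mean.norm_le_const (star f * f) (C ^ 2) (fun n => by
    simp only [BoundedContinuousFunction.coe_mul, Pi.mul_apply, BoundedContinuousFunction.star_apply, norm_mul, norm_star]
    rw [← sq]; gcongr; exact hC n)
  rw [← h1, Complex.norm_real, Real.norm_of_nonneg (by positivity)] at h2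
  exact (sq_le_sq₀ (norm_nonneg _) hC0).1 h2

lemma Sys.T_orth (hs : Sys M H ι T X) (g : H) :
    (∀ z, inner ℂ (ι (ch z)) (T g) = 0) ↔ (∀ z, inner ℂ (ι (ch z)) g = 0) := by
  refine forall_congr' fun z => ?_
  have : inner ℂ (ι (ch z)) g = conj (z : ℂ) * inner ℂ (ι (ch z)) (T g) := by
    rw [← T.inner_map_map, hs.T_eq, sh_ch, map_smul, inner_smul_left]
  rw [this]
  simp

variable [CompleteSpace H]

theorem Sys.weak (hs : Sys M H ι T X) (hE : Ext M) (ℓ m t : ℕ) (hm : 0 < m) (a : BF)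
    (w : Circle) (g : H) (hg : ∀ z, inner ℂ (ι (ch z)) g = 0) (f : BF) (D : ℝ)
    (hf : ∀ b, ‖f b‖ ≤ D * ‖(inner ℂ (ι (ch w * Fs ℓ m t a b)) g : ℂ)‖) : M f = 0 := by
  set V : Submodule ℂ H := (Submodule.span ℂ (Set.range fun z => ι (ch z)))ᗮ with hV
  have hmem : ∀ g, g ∈ V ↔ ∀ z, inner ℂ (ι (ch z)) g = 0 := fun g => by
    rw [hV, Submodule.mem_orthogonal]
    constructor
    · intro h z
      exact h _ (Submodule.subset_span ⟨z, rfl⟩)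
    · intro h u hu
      induction hu using Submodule.span_induction with
      | mem u hu => obtain ⟨z, rfl⟩ := hu; exact h z
      | zero => simp
      | add x y _ _ hx hy => rw [inner_add_left, hx, hy, add_zero]
      | smul a x _ hx => rw [inner_smul_left, hx, mul_zero]
  have hTV : ∀ g ∈ V, T g ∈ V := fun g hg => (hmem _).2 ((hs.T_orth g).2 ((hmem _).1 hg))
  let T0 : V →ₗᵢ[ℂ] V := ⟨T.toLinearMap.restrict hTV, fun v => T.norm_map v⟩
  have hT0 : ∀ v : V, ((T0 v : V) : H) = T v := fun v => rfl
  have hpow : ∀ (k : ℕ) (v : V), (((T0 ^ k) v : V) : H) = T^[k] v := fun k v => by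
    induction k with
    | zero => simp
    | succ k ih =>
      rw [pow_succ', Function.iterate_succ_apply', ← ih]
      rfl
  have hsurj : ∀ k : ℕ, Function.Surjective (T0 ^ k) := fun k => by
    induction k with
    | zero => intro v; exact ⟨v, rfl⟩
    | succ k ih =>
      rw [pow_succ']
      refine Function.Surjective.comp (g := T0) ?_ ih
      rintro ⟨v, hv⟩
      obtain ⟨u, rfl⟩ := hs.T_surj v
      exact ⟨⟨u, (hmem _).2 ((hs.T_orth u).1 ((hmem _).1 hv))⟩, rfl⟩
  have hC : ∀ b, ‖ι (ch w * Fs ℓ m t a b)‖ ≤ ‖a‖ := fun b => hs.norm_iota_le _ _ (fun n => by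
    rw [BoundedContinuousFunction.coe_mul, Pi.mul_apply, norm_mul, norm_ch_apply, one_mul]
    exact a.norm_coe_le_norm _)
  refine lemmaW hs.mean (T0 ^ m) (hsurj m) ?_ (fun b => V.orthogonalProjectionOnto (ι (ch w * Fs ℓ m t a b)))
    ‖a‖ (fun b => (V.norm_orthogonalProjectionOnto_apply_le _).trans (hC b)) ℓ ((w : ℂ) ^ m) (by rw [norm_pow, Circle.norm_coe, one_pow])
    ?_ (⟨g, (hmem _).2 hg⟩ : V) f D ?_
  · intro v c hv
    have hne : ∀ (v : V) (c : ℂ), T0.toLinearMap v = c • v → v = 0 := fun v c hv => by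
      have := hs.no_eig hE (v : H) c (congrArg Subtype.val hv) ((hmem _).1 v.2)
      exact Subtype.ext this
    refine no_eig_pow T0.toLinearMap hne m hm v c ?_
    rw [← hv]
    have : ∀ k : ℕ, (T0.toLinearMap ^ k) v = (T0 ^ k) v := fun k => by
      induction k with
      | zero => rfl
      | succ k ih => rw [pow_succ', pow_succ', Module.End.mul_apply, ih]; rfl
    exact this m
  · intro b g
    rw [V.inner_orthogonalProjectionOnto_eq_of_mem_right, V.inner_orthogonalProjectionOnto_eq_of_mem_right,
      hpow]
    have e1 : ∀ u v : H, inner ℂ (T^[m] u) (T^[m] v) = inner ℂ u v := fun u v => by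
      rw [← LinearIsometry.coe_pow]; exact (T ^ m).inner_map_map u v
    have e2 : (sh ^ m) (ch w * Fs ℓ m t a b) = ((w : ℂ) ^ m) • (ch w * Fs ℓ m t a (b + ℓ)) := by
      ext n
      rw [sh_pow_apply]
      simp only [BoundedContinuousFunction.coe_mul, Pi.mul_apply, BoundedContinuousFunction.coe_smul, ch_apply, Fs_apply, smul_eq_mul]
      rw [show ℓ * (n + m) + (m * b + t) = ℓ * n + (m * (b + ℓ) + t) by ring]
      ring
    rw [← e1 (ι _) (g : H), hs.T_pow, e2, map_smul, inner_smul_left, ← mul_assoc, Complex.mul_conj]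
    simp
  · intro b
    rw [V.inner_orthogonalProjectionOnto_eq_of_mem_right]
    exact hf b

end
end MBLB

open Filter MeasureTheory Topology
namespace MBLB
open scoped ComplexOrder BoundedContinuousFunction ComplexConjugate

open Classical in
/-- proportion of `E` staying in `E` after multiplication by `y` -/
noncomputable def cE (E : Finset Circle) (y : Circle) : ℝ :=
  ((E.filter (fun z => y * z ∈ E)).card : ℝ) / E.card

open Classical in
/-- boxes in the group generated by `S` -/
noncomputable def box (S : Finset Circle) (n : ℕ) : Finset Circle :=
  (Fintype.piFinset (fun _ : S => Finset.range n)).image (fun k => ∏ y : S, (y : Circle) ^ (k y))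

lemma box_card (S : Finset Circle) (n : ℕ) : (box S n).card ≤ n ^ S.card := by
  classical
  refine Finset.card_image_le.trans ?_
  rw [Fintype.card_piFinset]; simp

lemma box_mono (S : Finset Circle) (n : ℕ) : box S n ⊆ box S (n + 1) := by
  classical
  refine Finset.image_subset_image (Fintype.piFinset_subset _ _ fun _ => ?_)
  exact Finset.range_subset_range.2 (Nat.le_succ n)

lemma box_one (S : Finset Circle) (n : ℕ) : (1 : Circle) ∈ box S (n + 1) := by
  classical
  refine Finset.mem_image.2 ⟨fun _ => 0, ?_, by simp⟩
  simp [Fintype.mem_piFinset]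

lemma box_mul (S : Finset Circle) (n : ℕ) (y : Circle) (hy : y ∈ S) (z : Circle) (hz : z ∈ box S n) :
    y * z ∈ box S (n + 1) := by
  classical
  obtain ⟨k, hk, rfl⟩ := Finset.mem_image.1 hz
  rw [Fintype.mem_piFinset] at hk
  refine Finset.mem_image.2 ⟨fun x => k x + if x = ⟨y, hy⟩ then 1 else 0, ?_, ?_⟩
  · rw [Fintype.mem_piFinset]
    intro x
    have := hk x
    simp only [Finset.mem_range] at this ⊢
    split_ifs <;> omega
  · simp only [pow_add, Finset.prod_mul_distrib]
    rw [mul_comm y]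
    congr 1
    rw [Finset.prod_eq_single (⟨y, hy⟩ : S)]
    · simp
    · intro b _ hb; simp [hb]
    · simp

lemma exists_box (S : Finset Circle) (ε : ℝ) (hε : 0 < ε) :
    ∃ n : ℕ, ((box S (n + 2)).card : ℝ) ≤ (1 + ε) * (box S (n + 1)).card := by
  by_contra hcon
  push Not at hcon
  have h1 : ∀ n : ℕ, (1 + ε) ^ n ≤ ((box S (n + 1)).card : ℝ) := fun n => by
    induction n with
    | zero =>
      have : 0 < (box S 1).card := Finset.card_pos.2 ⟨1, box_one S 0⟩
      simpa using this
    | succ n ih =>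
      refine le_trans ?_ (hcon n).le
      rw [pow_succ']
      gcongr
  have h2 := tendsto_pow_const_div_const_pow_of_one_lt S.card (show 1 < 1 + ε by linarith)
  have h3 := (h2.comp (tendsto_add_atTop_nat 1)).eventually (gt_mem_nhds (show (0:ℝ) < (1 + ε)⁻¹ by positivity))
  obtain ⟨n, hn⟩ := h3.exists
  simp only [Function.comp] at hn
  rw [div_lt_iff₀ (by positivity), pow_succ' (1 + ε), inv_mul_cancel_left₀ (by positivity)] at hn
  have h4 : ((box S (n + 1)).card : ℝ) ≤ ((n + 1 : ℕ) : ℝ) ^ S.card := by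
    exact_mod_cast box_card S (n + 1)
  linarith [h1 n]

lemma exists_folner_set (S : Finset Circle) (ε : ℝ) (hε : 0 < ε) :
    ∃ E : Finset Circle, E.Nonempty ∧ ∀ y ∈ S, 1 - ε ≤ cE E y := by
  classical
  obtain ⟨n, hn⟩ := exists_box S ε hε
  refine ⟨box S (n + 1), ⟨1, box_one S n⟩, fun y hy => ?_⟩
  set E := box S (n + 1)
  set E' := box S (n + 2)
  have hpos : (0 : ℝ) < E.card := by exact_mod_cast Finset.card_pos.2 ⟨1, box_one S n⟩
  have hEE : E ⊆ E' := box_mono S (n + 1)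
  have h1 : (E.filter (fun z => ¬ y * z ∈ E)).card ≤ (E' \ E).card := by
    refine Finset.card_le_card_of_injOn (fun z => y * z) ?_ (fun a _ b _ h => mul_left_cancel h)
    intro z hz
    have hz := Finset.mem_filter.1 (Finset.mem_coe.1 hz)
    exact Finset.mem_coe.2 (Finset.mem_sdiff.2 ⟨box_mul S (n + 1) y hy z hz.1, hz.2⟩)
  have h2 : (E' \ E).card + E.card = E'.card := Finset.card_sdiff_add_card_eq_card hEE
  have h3 : (E.filter (fun z => y * z ∈ E)).card + (E.filter (fun z => ¬ y * z ∈ E)).card = E.card :=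
    Finset.card_filter_add_card_filter_not _
  have h1' : ((E.filter (fun z => ¬ y * z ∈ E)).card : ℝ) ≤ (E' \ E).card := by exact_mod_cast h1
  have h2' : ((E' \ E).card : ℝ) + E.card = E'.card := by exact_mod_cast h2
  have h3' : ((E.filter (fun z => y * z ∈ E)).card : ℝ) + (E.filter (fun z => ¬ y * z ∈ E)).card = E.card := by
    exact_mod_cast h3
  rw [cE, le_div_iff₀ hpos]
  nlinarith

lemma cE_le (E : Finset Circle) (y : Circle) : cE E y ≤ 1 := by
  classical
  rw [cE]
  refine div_le_one_of_le₀ ?_ (by positivity)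
  exact Nat.cast_le.2 (Finset.card_filter_le _ _)

lemma cE_one (E : Finset Circle) (hE : E.Nonempty) : cE E 1 = 1 := by
  classical
  rw [cE, Finset.filter_true_of_mem (fun z hz => by simpa using hz)]
  have : (E.card : ℝ) ≠ 0 := by exact_mod_cast (Finset.card_pos.2 hE).ne'
  exact div_self this

theorem exists_folner : ∃ (I : Type) (𝒰 : Ultrafilter I) (E : I → Finset Circle),
    (∀ i, (E i).Nonempty) ∧ ∀ y, Tendsto (fun i => cE (E i) y) 𝒰 (𝓝 1) := by
  choose E hE hE2 using fun p : Finset Circle × ℕ => exists_folner_set p.1 (1 / ((p.2 : ℝ) + 1)) (by positivity)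
  refine ⟨Finset Circle × ℕ, Ultrafilter.of (atTop ×ˢ atTop), E, hE, fun y => ?_⟩
  refine Tendsto.mono_left ?_ (Ultrafilter.of_le (atTop ×ˢ atTop))
  have h1 : Tendsto (fun p : Finset Circle × ℕ => 1 - 1 / ((p.2 : ℝ) + 1)) (atTop ×ˢ atTop) (𝓝 1) := by
    have := (tendsto_one_div_add_atTop_nhds_zero_nat (𝕜 := ℝ)).const_sub 1
    rw [sub_zero] at this
    exact this.comp tendsto_snd
  refine tendsto_of_tendsto_of_tendsto_of_le_of_le' h1 tendsto_const_nhds ?_ (Eventually.of_forall fun i => cE_le _ _)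
  have h2 : ∀ᶠ p : Finset Circle × ℕ in atTop ×ˢ atTop, {y} ⊆ p.1 :=
    tendsto_fst.eventually (eventually_ge_atTop ({y} : Finset Circle))
  filter_upwards [h2] with p hp
  exact hE2 p y (Finset.singleton_subset_iff.1 hp)

/-- the kernel -/
noncomputable def ker (E : Finset Circle) (b : ℕ) : BF :=
  (E.card : ℂ)⁻¹ • ∑ z ∈ E, ∑ w ∈ E, (ch (w * z⁻¹) b) • ch (z * w⁻¹)

lemma ch_mul_apply (z w : Circle) (n : ℕ) : ch (z * w) n = ch z n * ch w n := by
  rw [← ch_mul]; rfl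

lemma ch_inv_apply (z : Circle) (n : ℕ) : ch z⁻¹ n = conj (ch z n) := by
  rw [← ch_star]; rfl

lemma ker_apply (E : Finset Circle) (b n : ℕ) :
    ker E b n = (((E.card : ℝ)⁻¹ * ‖∑ z ∈ E, ch z n * conj (ch z b)‖ ^ 2 : ℝ) : ℂ) := by
  push_cast
  rw [← Complex.mul_conj', map_sum, Finset.sum_mul_sum]
  simp only [ker, BoundedContinuousFunction.coe_smul, BoundedContinuousFunction.coe_sum, Finset.sum_apply, smul_eq_mul]
  congr 1
  refine Finset.sum_congr rfl fun z _ => Finset.sum_congr rfl fun w _ => ?_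
  simp only [ch_mul_apply, ch_inv_apply, map_mul, Complex.conj_conj]
  ring

lemma ker_nonneg (E : Finset Circle) (b n : ℕ) : 0 ≤ ker E b n := by
  rw [ker_apply]
  exact_mod_cast (by positivity : (0:ℝ) ≤ (E.card : ℝ)⁻¹ * ‖∑ z ∈ E, ch z n * conj (ch z b)‖ ^ 2)

lemma ker_norm (E : Finset Circle) (b n : ℕ) : ‖ker E b n‖ ≤ E.card := by
  rw [ker_apply, Complex.norm_real, Real.norm_of_nonneg (by positivity)]
  have : ‖∑ z ∈ E, ch z n * conj (ch z b)‖ ≤ E.card := by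
    have := norm_sum_le_of_le E (fun z _ => (by simp : ‖ch z n * conj (ch z b)‖ ≤ 1))
    simpa using this
  rcases Nat.eq_zero_or_pos E.card with h | h
  · simp [h]
  have hpos : (0 : ℝ) < E.card := by exact_mod_cast h
  rw [inv_mul_le_iff₀ hpos, ← sq]
  gcongr

lemma ker_re (E : Finset Circle) (b n : ℕ) : ((ker E b n).re : ℂ) = ker E b n := by
  rw [ker_apply, Complex.ofReal_re]

lemma ker_norm_eq (E : Finset Circle) (b n : ℕ) : (‖ker E b n‖ : ℂ) = ker E b n := by
  rw [ker_apply, Complex.norm_real, Real.norm_of_nonneg (by positivity)]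

section
variable {M : BF →ₗ[ℂ] ℂ} (hM : IsMean M)
include hM

lemma IsMean.ch_ker (E : Finset Circle) (b : ℕ) (y : Circle) :
    M (ch y * ker E b) = (cE E y : ℂ) * ch y b := by
  classical
  have h1 : ∀ z w : Circle, ch y * (ch (w * z⁻¹) b • ch (z * w⁻¹)) = ch (w * z⁻¹) b • ch (y * z * w⁻¹) := fun z w => by
    rw [mul_smul_comm, ch_mul, mul_assoc]
  have h2 : ∀ z w : Circle, M (ch y * (ch (w * z⁻¹) b • ch (z * w⁻¹))) = if w = y * z then ch y b else 0 := fun z w => by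
    rw [h1, map_smul, hM.ch_eq, mul_inv_eq_one]
    by_cases h : w = y * z
    · simp [h]
    · simp [h, Ne.symm h]
  rw [ker, mul_smul_comm, map_smul, Finset.mul_sum, map_sum]
  simp_rw [Finset.mul_sum, map_sum, h2, Finset.sum_ite_eq']
  rw [← Finset.sum_filter, Finset.sum_const, cE]
  simp
  ring

lemma IsMean.ker_one (E : Finset Circle) (hE : E.Nonempty) (b : ℕ) : M (ker E b) = 1 := by
  have := hM.ch_ker E b 1
  rw [ch_one, one_mul, cE_one E hE] at this
  simpa using this

lemma IsMean.ker_ker (E : Finset Circle) (hE : E.Nonempty) (u v : BF) (hv : ∀ b, v b = M (u * ker E b)) :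
    M v = M u := by
  classical
  have e : v = (E.card : ℂ)⁻¹ • ∑ z ∈ E, ∑ w ∈ E, M (u * ch (z * w⁻¹)) • ch (w * z⁻¹) := by
    ext b
    rw [hv, ker, mul_smul_comm, map_smul, Finset.mul_sum, map_sum]
    simp_rw [Finset.mul_sum, map_sum, mul_smul_comm, map_smul]
    simp only [BoundedContinuousFunction.coe_smul, BoundedContinuousFunction.coe_sum, Finset.sum_apply, smul_eq_mul]
    congr 1
    refine Finset.sum_congr rfl fun z _ => Finset.sum_congr rfl fun w _ => mul_comm _ _
  have h2 : ∀ z w : Circle, M (u * ch (z * w⁻¹)) * M (ch (w * z⁻¹)) = if w = z then M u else 0 := fun z w => by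
    rw [hM.ch_eq, mul_inv_eq_one]
    by_cases h : w = z
    · simp [h, ch_one]
    · simp [h]
  rw [e, map_smul, map_sum]
  simp_rw [map_sum, map_smul, smul_eq_mul, h2, Finset.sum_ite_eq']
  have : (E.card : ℂ) ≠ 0 := by exact_mod_cast (Finset.card_pos.2 hE).ne'
  rw [Finset.sum_congr rfl (fun z hz => if_pos hz)]
  simp [this]

end
end MBLB

open Filter MeasureTheory Topology
namespace MBLB
open scoped ComplexOrder BoundedContinuousFunction ComplexConjugate

section
variable {M : BF →ₗ[ℂ] ℂ}

lemma IsMean.ker_bound (hM : IsMean M) (E : Finset Circle) (hE : E.Nonempty) (b : ℕ) (F : BF)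
    (hF : ∀ n, ‖F n‖ ≤ 1) : ‖M (ker E b * F)‖ ≤ 1 := by
  have := hM.isPos.norm_le (ker E b * F) (ker E b) (fun n => by
    have h1 : (ker E b n).re = ‖ker E b n‖ := by
      apply Complex.ofReal_injective; rw [ker_re, ker_norm_eq]
    rw [h1]
    simp only [BoundedContinuousFunction.coe_mul, Pi.mul_apply, norm_mul]
    exact mul_le_of_le_one_right (norm_nonneg _) (hF n))
  rwa [hM.ker_one E hE, Complex.one_re] at this

lemma IsMean.ch_close (hM : IsMean M) (E : Finset Circle) (hE : E.Nonempty) (b : ℕ) (F : BF)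
    (hF : ∀ n, ‖F n‖ ≤ 1) (y : Circle) (δ : ℝ) (hδ : 0 < δ) :
    ‖M (ker E b * F * ch y) - ch y b * M (ker E b * F)‖ ≤ δ / 2 + (1 - cE E y) / δ := by
  have e1 : M (ker E b * F * ch y) - ch y b * M (ker E b * F) =
      M (ker E b * F * (ch y - ch y b • 1)) := by
    rw [mul_sub, map_sub, mul_smul_comm, map_smul, mul_one, smul_eq_mul]
  let G : BF := ((δ / 2 + 1 / δ : ℝ) : ℂ) • ker E b - ((1 / δ : ℝ) : ℂ) • (conj (ch y b) • (ch y * ker E b))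
  have hG : (M G).re = δ / 2 + (1 - cE E y) / δ := by
    have hn : conj (ch y b) * ch y b = 1 := by rw [Complex.conj_mul']; simp
    have : M G = ((δ / 2 + (1 - cE E y) / δ : ℝ) : ℂ) := by
      simp only [G, map_sub, map_smul, hM.ker_one E hE, hM.ch_ker, smul_eq_mul]
      rw [show conj (ch y b) * ((cE E y : ℂ) * ch y b) = cE E y * (conj (ch y b) * ch y b) by ring, hn]
      push_cast; ring
    rw [this, Complex.ofReal_re]
  rw [e1, ← hG]
  refine hM.isPos.norm_le _ _ (fun n => ?_)
  have h1 : (ker E b n) = (‖ker E b n‖ : ℂ) := (ker_norm_eq E b n).symm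
  set k := ‖ker E b n‖ with hk
  set x := ch y n with hx
  set w := ch y b with hw
  have hx1 : ‖x‖ = 1 := norm_ch_apply _ _
  have hw1 : ‖w‖ = 1 := norm_ch_apply _ _
  have hGn : (G n).re = k * (δ / 2 + 1 / δ - (1 / δ) * (conj w * x).re) := by
    have : G n = (k : ℂ) * (((δ / 2 + 1 / δ : ℝ) : ℂ) - ((1 / δ : ℝ) : ℂ) * (conj w * x)) := by
      simp only [G, BoundedContinuousFunction.coe_sub, BoundedContinuousFunction.coe_smul, BoundedContinuousFunction.coe_mul, Pi.sub_apply, Pi.mul_apply, smul_eq_mul, h1, ← hx]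
      ring
    rw [this, Complex.re_ofReal_mul, Complex.sub_re, Complex.re_ofReal_mul, Complex.ofReal_re]
  have hL : ‖(ker E b * F * (ch y - w • 1)) n‖ ≤ k * ‖x - w‖ := by
    have : (ker E b * F * (ch y - w • 1)) n = ker E b n * F n * (x - w) := by
      simp [hx]
    rw [this, norm_mul, norm_mul, ← hk]
    have := hF n
    gcongr
    exact mul_le_of_le_one_right (norm_nonneg _) this
  refine hL.trans ?_
  rw [hGn]
  refine mul_le_mul_of_nonneg_left ?_ (norm_nonneg _)
  have hsq : ‖x - w‖ ^ 2 = 2 - 2 * (conj w * x).re := by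
    have := Complex.sq_norm_sub_sq_re
    rw [Complex.sq_norm, Complex.normSq_sub, ← Complex.sq_norm, ← Complex.sq_norm, hx1, hw1]
    rw [mul_comm x]; ring
  have h2 : ‖x - w‖ ≤ δ / 2 + ‖x - w‖ ^ 2 / (2 * δ) := by
    rw [← sub_nonneg]
    have : δ / 2 + ‖x - w‖ ^ 2 / (2 * δ) - ‖x - w‖ = (‖x - w‖ - δ) ^ 2 / (2 * δ) := by
      field_simp; ring
    rw [this]; positivity
  refine h2.trans (le_of_eq ?_)
  rw [hsq]; field_simp; ring

end

section nu
variable {M : BF →ₗ[ℂ] ℂ} (hM : IsMean M) {I : Type} {𝒰 : Ultrafilter I} {E : I → Finset Circle}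
  (hE : ∀ i, (E i).Nonempty) {F : ℕ → BF} (hF : ∀ b n, ‖F b n‖ ≤ 1) (hF0 : ∀ b n, 0 ≤ F b n)
  {ψ : I → BF} (hψ : ∀ i b, ψ i b = M (ker (E i) b * F b))
  {ν : BF →ₗ[ℂ] ℂ} (hν : ∀ f, Tendsto (fun i => M (f * ψ i)) 𝒰 (𝓝 (ν f)))

include hM hE hF hψ in
lemma psi_norm (i : I) (b : ℕ) : ‖ψ i b‖ ≤ 1 := by
  rw [hψ]; exact hM.ker_bound _ (hE i) _ _ (hF b)

include hM hF0 hψ in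
lemma psi_nonneg (i : I) (b : ℕ) : 0 ≤ ψ i b := by
  rw [hψ]; exact hM.pos _ (fun n => mul_nonneg (ker_nonneg _ _ _) (hF0 b n))

include hM hF0 hψ hν in
lemma nu_pos : IsPos ν := fun f hf =>
  ge_of_tendsto' (hν f) (fun i => hM.pos _ (fun n => mul_nonneg (hf n) (psi_nonneg hM hF0 hψ i n)))

include hM hE hF hψ hν in
lemma nu_le (f g : BF) (h : ∀ n, ‖f n‖ ≤ (g n).re) : ‖ν f‖ ≤ (M g).re :=
  le_of_tendsto' (hν f).norm (fun i => hM.isPos.norm_le _ _ (fun n => by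
    refine le_trans ?_ (h n)
    rw [BoundedContinuousFunction.coe_mul, Pi.mul_apply, norm_mul]
    exact mul_le_of_le_one_right (norm_nonneg _) (psi_norm hM hE hF hψ i n)))

include hM hE hF hψ hν in
lemma nu_char (D : Set ℕ) (p : BF) (hp : p ∈ Submodule.span ℂ (Set.range ch))
    (hcE : ∀ y, Tendsto (fun i => cE (E i) y) 𝒰 (𝓝 1))
    (u : BF → I → BF) (hu : ∀ f i b, u f i b = ind D b * M (ker (E i) b * F b * f)) :
    Tendsto (fun i => M (u p i)) 𝒰 (𝓝 (ν (ind D * p))) := by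
  induction hp using Submodule.span_induction with
  | mem p hp =>
    obtain ⟨y, rfl⟩ := hp
    have : Tendsto (fun i => M (u (ch y) i) - M (ind D * ch y * ψ i)) 𝒰 (𝓝 0) := by
      rw [Metric.tendsto_nhds]
      intro ε hε
      have h1 := (hcE y).eventually (lt_mem_nhds (show 1 - ε ^ 2 / 4 < 1 by nlinarith [pow_pos hε 2]))
      filter_upwards [h1] with i hi
      rw [dist_zero_right, ← map_sub]
      have hb : ‖M (u (ch y) i - ind D * ch y * ψ i)‖ ≤ ε / 2 + ε / 4 := by
        refine hM.norm_le_const _ _ (fun b => ?_)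
        have e : (u (ch y) i - ind D * ch y * ψ i) b = ind D b *
            (M (ker (E i) b * F b * ch y) - ch y b * M (ker (E i) b * F b)) := by
          simp only [BoundedContinuousFunction.coe_sub, BoundedContinuousFunction.coe_mul, Pi.sub_apply, Pi.mul_apply, hu, hψ]
          ring
        rw [e, norm_mul]
        have hD : ‖ind D b‖ ≤ 1 := by rw [ind_apply]; split_ifs <;> simp
        have hc := hM.ch_close (E i) (hE i) b (F b) (hF b) y ε hε
        have : (1 - cE (E i) y) / ε ≤ ε / 4 := by
          rw [div_le_iff₀ hε]; nlinarith
        have hc' := hc.trans (add_le_add_right this _)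
        exact (mul_le_of_le_one_left (norm_nonneg _) hD).trans hc'
      linarith
    have := this.add (hν (ind D * ch y))
    simpa using this
  | zero =>
    have : ∀ i, u 0 i = 0 := fun i => by ext b; rw [hu]; simp
    simp [this]
  | add p q _ _ hp hq =>
    have : ∀ i, u (p + q) i = u p i + u q i := fun i => by
      ext b; simp [hu, mul_add]
    simp_rw [this, mul_add, map_add]
    exact hp.add hq
  | smul c p _ hp =>
    have : ∀ i, u (c • p) i = c • u p i := fun i => by
      ext b; simp [hu, mul_smul_comm]; ring
    simp_rw [this, mul_smul_comm, map_smul]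
    exact hp.const_smul c

end nu
end MBLB

open Filter MeasureTheory Topology
namespace MBLB
open scoped ComplexOrder BoundedContinuousFunction ComplexConjugate

section
variable {M : BF →ₗ[ℂ] ℂ} {H : Type} [NormedAddCommGroup H] [InnerProductSpace ℂ H]
  {ι : BF →ₗ[ℂ] H} {T : H →ₗᵢ[ℂ] H} {X : Circle → H →ₗᵢ[ℂ] H}

lemma Sys.abs_le (hs : Sys M H ι T X) (f : BF) : (M (absB f)).re ≤ ‖ι f‖ := by
  have h1 := norm_sq_iota hs.inner_eq f
  have h2 := hs.mean.abs_le f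
  rw [← h1, Complex.ofReal_re] at h2
  exact (Complex.re_le_norm _).trans (by
    exact (sq_le_sq₀ (norm_nonneg _) (norm_nonneg _)).1 h2)

/-- Riesz representation of bounded functionals on `BF`. -/
lemma Sys.riesz [CompleteSpace H] (hs : Sys M H ι T X) (L : BF →ₗ[ℂ] ℂ) (hL : ∀ f, ‖L f‖ ≤ ‖ι f‖) :
    ∃ g : H, ∀ f, inner ℂ g (ι f) = L f := by
  let φ : H →L[ℂ] ℂ := L.extendOfNorm ι
  refine ⟨(InnerProductSpace.toDual ℂ H).symm φ, fun f => ?_⟩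
  rw [InnerProductSpace.toDual_symm_apply]
  exact LinearMap.extendOfNorm_eq hs.dense ⟨1, fun f => by simpa using hL f⟩ f

lemma ker_star (E : Finset Circle) (b : ℕ) : star (ker E b) = ker E b := by
  ext n
  rw [BoundedContinuousFunction.star_apply, ← ker_re]
  exact Complex.conj_ofReal _

/-- the functional `Λ` -/
lemma exists_Lam (hs : Sys M H ι T X) (E : Finset Circle) (hE : E.Nonempty)
    (F : ℕ → BF) (hF : ∀ b n, ‖F b n‖ ≤ 1) (D : Set ℕ) :
    ∃ u : H →ₗ[ℂ] BF, (∀ g b, u g b = ind D b * inner ℂ (ι (ker E b * F b)) g) ∧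
      ∀ g, ‖M (u g)‖ ≤ ‖g‖ := by
  have hk : ∀ b n, ‖(ker E b * F b) n‖ ≤ E.card := fun b n => by
    rw [BoundedContinuousFunction.coe_mul, Pi.mul_apply, norm_mul]
    exact (mul_le_of_le_one_right (norm_nonneg _) (hF b n)).trans (ker_norm E b n)
  have hx : ∀ b, ‖ι (ker E b * F b)‖ ≤ E.card := fun b => hs.norm_iota_le _ _ (hk b)
  let u : H →ₗ[ℂ] BF := (LinearMap.mulLeft ℂ (ind D)).comp (cf (fun b => ι (ker E b * F b)) E.card hx)
  have hu : ∀ g b, u g b = ind D b * inner ℂ (ι (ker E b * F b)) g := fun g b => rfl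
  have hD : ∀ b, ‖ind D b‖ ≤ 1 := fun b => by rw [ind_apply]; split_ifs <;> simp
  refine ⟨u, hu, ?_⟩
  have hc : Continuous (fun g => ‖M (u g)‖) := by
    have : Continuous (M.comp u) := AddMonoidHomClass.continuous_of_bound (M.comp u) (E.card : ℝ) (fun g => by
      refine hs.mean.norm_le_const _ _ (fun b => ?_)
      rw [hu, norm_mul]
      refine (mul_le_of_le_one_left (norm_nonneg _) (hD b)).trans ?_
      refine (norm_inner_le_norm _ _).trans ?_
      gcongr; exact hx b)
    exact this.norm
  intro g
  refine hs.dense.induction_on (p := fun g => ‖M (u g)‖ ≤ ‖g‖) g (isClosed_le hc continuous_norm) (fun f => ?_)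
  refine le_trans ?_ (hs.abs_le f)
  have hb : ∀ b, ‖M (absB f * ker E b)‖ ≤ E.card * ‖f‖ := fun b => by
    refine hs.mean.norm_le_const _ _ (fun n => ?_)
    rw [BoundedContinuousFunction.coe_mul, Pi.mul_apply, norm_mul, mul_comm, absB_apply, Complex.norm_real, norm_norm]
    gcongr
    · exact ker_norm E b n
    · exact f.norm_coe_le_norm n
  rw [← hs.mean.ker_ker E hE (absB f) (bf (fun b => M (absB f * ker E b)) _ hb) (fun b => rfl)]
  refine hs.mean.isPos.norm_le _ _ (fun b => ?_)
  rw [hu, norm_mul, bf_apply]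
  refine (mul_le_of_le_one_left (norm_nonneg _) (hD b)).trans ?_
  rw [hs.inner_eq]
  refine hs.mean.isPos.norm_le _ _ (fun n => ?_)
  have : (absB f * ker E b) n = ((‖f n‖ * ‖ker E b n‖ : ℝ) : ℂ) := by
    rw [BoundedContinuousFunction.coe_mul, Pi.mul_apply, absB_apply]; push_cast; rw [ker_norm_eq]
  rw [this, Complex.ofReal_re]
  simp only [BoundedContinuousFunction.coe_mul, Pi.mul_apply, BoundedContinuousFunction.star_apply, norm_mul, norm_star]
  have := hF b n
  rw [mul_comm]
  gcongr
  exact mul_le_of_le_one_right (norm_nonneg _) this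

variable [CompleteSpace H]

/-- The key lemma. -/
theorem key (hs : Sys M H ι T X) (hExt : Ext M) (ℓ m t : ℕ) (hm : 0 < m) (a : BF)
    (ha : ∀ n, ‖a n‖ ≤ 1) (ha0 : ∀ n, 0 ≤ a n)
    {I : Type} {𝒰 : Ultrafilter I} {E : I → Finset Circle} (hE : ∀ i, (E i).Nonempty)
    (hcE : ∀ y, Tendsto (fun i => cE (E i) y) 𝒰 (𝓝 1))
    {ψ : I → BF} (hψ : ∀ i b, ψ i b = M (ker (E i) b * Fs ℓ m t a b))
    {ν : BF →ₗ[ℂ] ℂ} (hν : ∀ f, Tendsto (fun i => M (f * ψ i)) 𝒰 (𝓝 (ν f)))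
    (D : Set ℕ) (hD : ν (ind D) ≠ 0) : ∃ b ∈ D, ν (ind D * Fs ℓ m t a b) ≠ 0 := by
  by_contra hcon
  push Not at hcon
  have hF : ∀ b n, ‖Fs ℓ m t a b n‖ ≤ 1 := fun b n => ha _
  have hF0 : ∀ b n, 0 ≤ Fs ℓ m t a b n := fun b n => ha0 _
  have hFs : ∀ b, star (Fs ℓ m t a b) = Fs ℓ m t a b := fun b => by
    ext n
    rw [BoundedContinuousFunction.star_apply]
    exact Complex.conj_eq_iff_im.2 (Complex.nonneg_iff.1 (hF0 b n)).2.symm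
  have hνp := nu_pos hs.mean hF0 hψ hν
  have hD1 : ∀ b, ‖ind D b‖ ≤ 1 := fun b => by rw [ind_apply]; split_ifs <;> simp
  obtain ⟨g, hg⟩ := hs.riesz (ν.comp (LinearMap.mulLeft ℂ (ind D))) (fun f => by
    refine le_trans ?_ (hs.abs_le f)
    refine nu_le hs.mean hE hF hψ hν _ _ (fun n => ?_)
    simp only [LinearMap.mulLeft_apply, BoundedContinuousFunction.coe_mul, Pi.mul_apply, norm_mul, absB_apply, Complex.ofReal_re]
    exact mul_le_of_le_one_left (norm_nonneg _) (hD1 n))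
  replace hg : ∀ f, inner ℂ g (ι f) = ν (ind D * f) := hg
  -- vanishing of correlations
  have hz : ∀ b ∈ D, ∀ f : BF, inner ℂ (ι (f * Fs ℓ m t a b)) g = 0 := fun b hb f => by
    rw [← inner_conj_symm, hg, map_eq_zero, ← norm_le_zero_iff]
    have := hνp.norm_le (ind D * (f * Fs ℓ m t a b)) ((‖f‖ : ℂ) • (ind D * Fs ℓ m t a b)) (fun n => by
      have h1 : ∀ n, ind D n = (‖ind D n‖ : ℂ) := fun n => by rw [ind_apply]; split_ifs <;> simp
      have h2 : Fs ℓ m t a b n = (‖Fs ℓ m t a b n‖ : ℂ) := (Complex.norm_of_nonneg' (hF0 b n)).symm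
      have : ((‖f‖ : ℂ) • (ind D * Fs ℓ m t a b)) n = ((‖f‖ * (‖ind D n‖ * ‖Fs ℓ m t a b n‖) : ℝ) : ℂ) := by
        simp only [BoundedContinuousFunction.coe_smul, BoundedContinuousFunction.coe_mul, Pi.mul_apply, smul_eq_mul]
        push_cast
        rw [← h1, ← h2]
      rw [this, Complex.ofReal_re]
      simp only [BoundedContinuousFunction.coe_mul, Pi.mul_apply, norm_mul]
      have := f.norm_coe_le_norm n
      rw [mul_left_comm]
      gcongr)
    rw [map_smul, hcon b hb] at this
    simpa using this
  choose u hu hun using fun i => exists_Lam hs (E i) (hE i) (Fs ℓ m t a) hF D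
  have hug : ∀ i, M (u i g) = 0 := fun i => by
    have : u i g = 0 := by
      ext b
      rw [hu]
      by_cases hb : b ∈ D
      · rw [hz b hb]; simp
      · rw [ind_apply, if_neg hb]; simp
    rw [this, map_zero]
  set V : Submodule ℂ H := (Submodule.span ℂ (Set.range fun z => ι (ch z))).topologicalClosure with hV
  have : CompleteSpace V := (Submodule.isClosed_topologicalClosure _).completeSpace_coe
  obtain ⟨gc, hgc, gw, hgw, hgg⟩ := V.exists_add_mem_mem_orthogonal g
  have hchV : ∀ z, ι (ch z) ∈ V := fun z => Submodule.le_topologicalClosure _ (Submodule.subset_span ⟨z, rfl⟩)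
  have hw : ∀ z, inner ℂ (ι (ch z)) gw = 0 := fun z => (Submodule.mem_orthogonal _ _).1 hgw _ (hchV z)
  have hugw : ∀ i, M (u i gw) = 0 := fun i => by
    have hx : ∀ b, ‖ι (ker (E i) b * Fs ℓ m t a b)‖ ≤ (E i).card := fun b => hs.norm_iota_le _ _ (fun n => by
      rw [BoundedContinuousFunction.coe_mul, Pi.mul_apply, norm_mul]
      exact (mul_le_of_le_one_right (norm_nonneg _) (hF b n)).trans (ker_norm _ b n))
    have hx' : ∀ (z w : Circle) b, ‖ι (ch (z * w⁻¹) * Fs ℓ m t a b)‖ ≤ 1 := fun z w b => hs.norm_iota_le _ _ (fun n => by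
      rw [BoundedContinuousFunction.coe_mul, Pi.mul_apply, norm_mul, norm_ch_apply, one_mul]
      exact hF b n)
    have e : u i gw = ((E i).card : ℂ)⁻¹ • ∑ z ∈ E i, ∑ w ∈ E i,
        ind D * ch (z * w⁻¹) * cf (fun b => ι (ch (z * w⁻¹) * Fs ℓ m t a b)) 1 (hx' z w) gw := by
      ext b
      rw [hu, ker]
      simp only [BoundedContinuousFunction.coe_smul, BoundedContinuousFunction.coe_sum, Finset.sum_apply, smul_eq_mul,
        BoundedContinuousFunction.coe_mul, Pi.mul_apply, cf_apply, smul_mul_assoc, map_smul, Finset.sum_mul, map_sum,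
        sum_inner, inner_smul_left, map_inv₀, Complex.conj_natCast, Finset.mul_sum]
      refine Finset.sum_congr rfl fun z _ => Finset.sum_congr rfl fun w _ => ?_
      rw [← ch_inv_apply, mul_inv, inv_inv, mul_comm w⁻¹ z]
      ring
    rw [e, map_smul, map_sum]
    refine smul_eq_zero_of_right _ (Finset.sum_eq_zero fun z _ => ?_)
    rw [map_sum]
    refine Finset.sum_eq_zero fun w _ => ?_
    refine hs.weak hExt ℓ m t hm a (z * w⁻¹) gw hw _ 1 (fun b => ?_)
    simp only [BoundedContinuousFunction.coe_mul, Pi.mul_apply, cf_apply, norm_mul, norm_ch_apply, mul_one]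
    gcongr
    exact hD1 b
  have hugc : ∀ i, M (u i gc) = 0 := fun i => by
    have := hug i
    rw [hgg, map_add, map_add, hugw, add_zero] at this
    exact this
  -- approximation
  have happ : ∀ ε > 0, ‖(inner ℂ g gc : ℂ)‖ ≤ ε + ‖g‖ * ε := fun ε hε => by
    obtain ⟨q, hq, hqd⟩ := Metric.mem_closure_iff.1 hgc ε hε
    have hq' : q ∈ (Submodule.span ℂ (Set.range ch)).map ι := by
      rw [Submodule.map_span, ← Set.range_comp]; exact hq
    obtain ⟨p, hp, rfl⟩ := hq'
    have hlim := nu_char hs.mean hE hF hψ hν D p hp hcE (fun f i => u i (ι f)) (fun f i b => by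
      rw [hu, hs.inner_eq, star_mul, ker_star, hFs, mul_comm (Fs ℓ m t a b)])
    rw [dist_eq_norm] at hqd
    have hle : ‖ν (ind D * p)‖ ≤ ε := le_of_tendsto' hlim.norm (fun i => by
      have h1 : M (u i (ι p)) = M (u i (ι p - gc)) := by rw [map_sub, map_sub, hugc, sub_zero]
      rw [h1]
      refine (hun i _).trans ?_
      rw [norm_sub_rev]; exact hqd.le)
    have h2 : inner ℂ g gc = ν (ind D * p) + inner ℂ g (gc - ι p) := by
      rw [inner_sub_right, hg]; ring
    rw [h2]
    refine (norm_add_le _ _).trans (add_le_add hle ((norm_inner_le_norm _ _).trans ?_))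
    gcongr
  have hgc0 : gc = 0 := by
    have h1 : inner ℂ g gc = inner ℂ gc gc := by
      rw [hgg, inner_add_left, Submodule.inner_left_of_mem_orthogonal hgc hgw, add_zero]
    have h2 : ‖(inner ℂ g gc : ℂ)‖ ≤ 0 := by
      refine le_of_forall_pos_le_add fun ε hε => ?_
      refine (happ (ε / (1 + ‖g‖)) (by positivity)).trans (le_of_eq ?_)
      field_simp; ring
    rw [h1, norm_le_zero_iff, inner_self_eq_zero] at h2
    exact h2
  apply hD
  have h3 := hg 1
  rw [mul_one] at h3
  rw [← h3, ← ch_one, ← inner_conj_symm, hgg, hgc0, zero_add, hw, map_zero]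

end
end MBLB

open Filter MeasureTheory Topology
namespace MBLB
open scoped ComplexOrder BoundedContinuousFunction ComplexConjugate

section
variable {M : BF →ₗ[ℂ] ℂ}

/-- sum of the mean over residues -/
noncomputable def Sm (M : BF →ₗ[ℂ] ℂ) (p : ℕ) : BF →ₗ[ℂ] ℂ := ∑ t ∈ Finset.range p, M.comp (dil p t)

lemma Sm_apply (p : ℕ) (u : BF) : Sm M p u = ∑ t ∈ Finset.range p, M (dil p t u) := by
  simp [Sm]

lemma dil_sh (p t : ℕ) (u : BF) : dil p t (sh u) = dil p (t + 1) u := by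
  ext n; simp [add_assoc]

lemma dil_add (p t : ℕ) (u : BF) : dil p (t + p) u = sh (dil p t u) := by
  ext n; simp only [dil_apply, sh_apply]; congr 1; ring

lemma Sm_sh (hM : IsMean M) (p : ℕ) (u : BF) : Sm M p (sh u) = Sm M p u := by
  rw [Sm_apply, Sm_apply]
  simp_rw [dil_sh]
  have h1 := Finset.sum_range_succ (fun t => M (dil p t u)) p
  rw [Finset.sum_range_succ'] at h1
  have h2 : M (dil p p u) = M (dil p 0 u) := by
    have := dil_add p 0 u
    rw [zero_add] at this
    rw [this, hM.shift]
  rw [h2] at h1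
  exact add_right_cancel h1

lemma Sm_sh_pow (hM : IsMean M) (p k : ℕ) (u : BF) : Sm M p ((sh ^ k) u) = Sm M p u := by
  induction k with
  | zero => simp
  | succ k ih => rw [pow_succ', Module.End.mul_apply, Sm_sh hM, ih]

lemma M_avd (p : ℕ) (hp : 0 < p) (u : BF) : (p : ℂ) * M (avd p u) = Sm M p u := by
  have : (p : ℂ) ≠ 0 := by exact_mod_cast hp.ne'
  rw [avd, map_smul, map_sum, Sm_apply, smul_eq_mul, mul_inv_cancel_left₀ this]

lemma gam_bound (hM : IsMean M) (ℓ : ℕ) (a : BF) (z : Circle) (k : ℕ) : ‖M (ch z * dil ℓ k a)‖ ≤ ‖a‖ :=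
  hM.norm_le_const _ _ (fun n => by
    rw [BoundedContinuousFunction.coe_mul, Pi.mul_apply, norm_mul, norm_ch_apply, one_mul]
    exact a.norm_coe_le_norm _)

lemma gam_add (hM : IsMean M) (ℓ : ℕ) (a : BF) (z : Circle) (k b : ℕ) :
    M (ch z * dil ℓ (k + ℓ * b) a) = ch z⁻¹ b * M (ch z * dil ℓ k a) := by
  rw [← hM.shift_iter b (ch z * dil ℓ k a), ← smul_eq_mul (ch z⁻¹ b), ← M.map_smul]
  congr 1
  ext n
  have : ch z (n + b) = ch z n * ch z b := by simp only [ch_apply, pow_add]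
  have h2 : ch z⁻¹ b * ch z b = 1 := by rw [← ch_mul_apply]; simp [ch_one]
  simp only [BoundedContinuousFunction.coe_smul, BoundedContinuousFunction.coe_mul, Pi.mul_apply, smul_eq_mul, sh_pow_apply, dil_apply, this]
  rw [show ℓ * n + (k + ℓ * b) = ℓ * (n + b) + k by ring]
  linear_combination (-(ch z n * a (ℓ * (n + b) + k))) * h2

open Classical in
lemma Sm_gam (hM : IsMean M) (ℓ p : ℕ) (hℓ : 0 < ℓ) (a : BF) (z : Circle) (γ : BF)
    (hγ : ∀ k, γ k = M (ch z * dil ℓ k a)) : Sm M p γ = if z = 1 then (p : ℂ) * M (avd ℓ a) else 0 := by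
  have h1 : (sh ^ ℓ) γ = ((z⁻¹ : Circle) : ℂ) • γ := by
    ext k
    have := gam_add hM ℓ a z k 1
    rw [mul_one] at this
    rw [sh_pow_apply, hγ, this, ← hγ, ch_apply, pow_one]; rfl
  split_ifs with hz
  · subst hz
    have hℓ' : (ℓ : ℂ) ≠ 0 := by exact_mod_cast hℓ.ne'
    apply mul_left_cancel₀ hℓ'
    have e1 : ∑ j ∈ Finset.range ℓ, (sh ^ j) γ = ((ℓ : ℂ) * M (avd ℓ a)) • (1 : BF) := by
      ext k
      simp only [BoundedContinuousFunction.coe_sum, Finset.sum_apply, sh_pow_apply, BoundedContinuousFunction.coe_smul,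
        BoundedContinuousFunction.coe_one, Pi.one_apply, smul_eq_mul, mul_one]
      rw [M_avd ℓ hℓ, Sm_apply]
      induction k with
      | zero => simp [hγ, ch_one]
      | succ k ih =>
        rw [← ih]
        have h2 := Finset.sum_range_succ (fun t => γ (k + t)) ℓ
        rw [Finset.sum_range_succ'] at h2
        have h3 : γ (k + ℓ) = γ (k + 0) := by
          rw [← sh_pow_apply, h1]; simp
        rw [h3] at h2
        have h4 := add_right_cancel h2
        rw [← h4]
        refine Finset.sum_congr rfl fun j _ => ?_
        congr 1; ring
    have e2 := congrArg (Sm M p) e1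
    rw [map_sum, map_smul] at e2
    simp_rw [Sm_sh_pow hM] at e2
    have e3 : Sm M p 1 = p := by
      rw [Sm_apply]
      have : ∀ t, dil p t 1 = 1 := fun t => by ext n; simp
      simp [this, hM.one]
    rw [e3] at e2
    simp only [Finset.sum_const, Finset.card_range, nsmul_eq_mul, smul_eq_mul] at e2
    rw [e2]; ring
  · have h2 := Sm_sh_pow hM p ℓ γ
    rw [h1, map_smul, smul_eq_mul] at h2
    by_contra h0
    apply hz
    have h3 : ((z⁻¹ : Circle) : ℂ) = 1 := by
      apply mul_right_cancel₀ h0; rw [h2, one_mul]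
    have h4 : z⁻¹ = 1 := by
      apply Circle.coe_injective; simpa using h3
    simpa using h4

theorem mass (hM : IsMean M) (ℓ m : ℕ) (hℓ : 0 < ℓ) (a : BF) (E : Finset Circle) (hE : E.Nonempty)
    (ψ : ℕ → BF) (hψ : ∀ t b, ψ t b = M (ker E b * Fs ℓ m t a b)) :
    ∑ t ∈ Finset.range (m + ℓ), M (ψ t) = ((m + ℓ : ℕ) : ℂ) * M (avd ℓ a) := by
  classical
  let γ : Circle → BF := fun z => bf (fun k => M (ch z * dil ℓ k a)) _ (gam_bound hM ℓ a z)
  have hγ : ∀ z k, γ z k = M (ch z * dil ℓ k a) := fun z k => rfl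
  have e : ∀ t, ψ t = (E.card : ℂ)⁻¹ • ∑ z ∈ E, ∑ w ∈ E, dil (m + ℓ) t (γ (z * w⁻¹)) := fun t => by
    ext b
    rw [hψ, ker]
    simp only [smul_mul_assoc, map_smul, Finset.sum_mul, map_sum, BoundedContinuousFunction.coe_smul, BoundedContinuousFunction.coe_sum, Finset.sum_apply, smul_eq_mul, dil_apply]
    congr 1
    refine Finset.sum_congr rfl fun z _ => Finset.sum_congr rfl fun w _ => ?_
    rw [hγ, show (m + ℓ) * b + t = (m * b + t) + ℓ * b by ring, gam_add hM, Fs, mul_inv, inv_inv, mul_comm w]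
  have e2 : ∑ t ∈ Finset.range (m + ℓ), M (ψ t) = (E.card : ℂ)⁻¹ * ∑ z ∈ E, ∑ w ∈ E, Sm M (m + ℓ) (γ (z * w⁻¹)) := by
    simp_rw [e, map_smul, map_sum, Sm_apply, smul_eq_mul, ← Finset.mul_sum]
    congr 1
    rw [Finset.sum_comm]
    refine Finset.sum_congr rfl fun z _ => Finset.sum_comm
  rw [e2]
  have h3 : ∀ z ∈ E, ∑ w ∈ E, Sm M (m + ℓ) (γ (z * w⁻¹)) = ((m + ℓ : ℕ) : ℂ) * M (avd ℓ a) := fun z hz => by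
    rw [Finset.sum_eq_single z]
    · rw [Sm_gam hM ℓ (m + ℓ) hℓ a _ _ (hγ _), if_pos (by simp)]
    · intro w _ hw
      rw [Sm_gam hM ℓ (m + ℓ) hℓ a _ _ (hγ _), if_neg]
      rw [mul_inv_eq_one]; exact hw.symm
    · exact fun h => absurd hz h
  rw [Finset.sum_congr rfl h3, Finset.sum_const, nsmul_eq_mul]
  have : (E.card : ℂ) ≠ 0 := by exact_mod_cast (Finset.card_pos.2 hE).ne'
  rw [inv_mul_cancel_left₀ this]

lemma mean_finite (hM : IsMean M) (N : ℕ) : M (ind (Set.Iic N)) = 0 := by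
  rw [← hM.shift_iter (N + 1)]
  have : (sh ^ (N + 1)) (ind (Set.Iic N)) = 0 := by
    ext n; rw [sh_pow_apply, ind_apply, if_neg (by simp; omega)]; rfl
  rw [this, map_zero]

end

/-- from the inductive step to the infinite set -/
lemma build (P : Set ℕ → Prop) (R : ℕ → Set ℕ) (D₀ : Set ℕ) (h0 : P D₀)
    (hstep : ∀ D, P D → ∀ N, ∃ b ∈ D, N < b ∧ P (D ∩ R b)) :
    ∃ B : Set ℕ, B.Infinite ∧ ∀ b₁ ∈ B, ∀ b₂ ∈ B, b₁ ≤ b₂ → (b₁ = b₂ ∧ b₁ ∈ D₀) ∨ b₂ ∈ R b₁ := by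
  choose f hf hN hP using hstep
  let S := {x : Set ℕ × ℕ // P x.1}
  let nx : S → S := fun s => ⟨(s.1.1 ∩ R (f s.1.1 s.2 s.1.2), f s.1.1 s.2 s.1.2), hP _ _ _⟩
  let s : ℕ → S := fun k => nx^[k] ⟨(D₀, 0), h0⟩
  have hs : ∀ k, s (k + 1) = nx (s k) := fun k => Function.iterate_succ_apply' _ _ _
  let b : ℕ → ℕ := fun k => (s (k + 1)).1.2
  have hbD : ∀ k, b k ∈ (s k).1.1 := fun k => by
    simp only [b, hs k]; exact hf _ _ _
  have hmono : StrictMono b := strictMono_nat_of_lt_succ fun k => by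
    have : b (k + 1) = f (s (k + 1)).1.1 (s (k + 1)).2 (s (k + 1)).1.2 := by
      simp only [b, hs (k + 1)]; rfl
    rw [this]; exact hN _ _ _
  have hD1 : ∀ k, (s (k + 1)).1.1 = (s k).1.1 ∩ R (b k) := fun k => by
    simp only [b, hs k]; rfl
  have hanti : Antitone fun k => (s k).1.1 := antitone_nat_of_succ_le fun k => by
    rw [hD1]; exact Set.inter_subset_left
  refine ⟨Set.range b, Set.infinite_range_of_injective hmono.injective, ?_⟩
  rintro _ ⟨i, rfl⟩ _ ⟨j, rfl⟩ hij
  rcases (hmono.le_iff_le.1 hij).eq_or_lt with rfl | hlt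
  · exact Or.inl ⟨rfl, hanti (Nat.zero_le i) (hbD i)⟩
  · right
    have h1 : b j ∈ (s (i + 1)).1.1 := hanti hlt (hbD j)
    rw [hD1] at h1
    exact h1.2

lemma ind_nonneg (D : Set ℕ) (n : ℕ) : 0 ≤ ind D n := by
  rw [ind_apply]; split_ifs <;> simp

lemma ind_norm (D : Set ℕ) (n : ℕ) : ‖ind D n‖ ≤ 1 := by
  rw [ind_apply]; split_ifs <;> simp

theorem main (ℓ m : ℕ) (hℓ : 0 < ℓ) (hm : 0 < m) (A : Set ℕ) (c : ℝ) (hc1 : 1 / 2 < c)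
    (hc : ∀ᶠ n in atTop, c ≤ (ces n (ind A)).re) :
    ∃ B : Set ℕ, B.Infinite ∧ ∃ t : ℕ,
      ∀ b₁ ∈ B, ∀ b₂ ∈ B, b₁ ≤ b₂ → m * b₁ + ℓ * b₂ + t ∈ A := by
  classical
  set p := m + ℓ with hp
  have hp0 : 0 < p := by omega
  obtain ⟨M0, hM0, hM01⟩ := exists_mean0 A c hc ℓ p hℓ hp0
  obtain ⟨M, hM, hExt, hM1⟩ := exists_ext (avd ℓ (ind A) + avd p (ind A)) 1 M0 hM0 (by linarith)
  obtain ⟨H, _, _, _, ι, T, X, hs⟩ := exists_sys M hM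
  obtain ⟨I, 𝒰, E, hE, hcE⟩ := exists_folner
  have hF : ∀ t b n, ‖Fs ℓ m t (ind A) b n‖ ≤ 1 := fun t b n => ind_norm _ _
  have hF0 : ∀ t b n, 0 ≤ Fs ℓ m t (ind A) b n := fun t b n => ind_nonneg _ _
  let ψ : ℕ → I → BF := fun t i => bf (fun b => M (ker (E i) b * Fs ℓ m t (ind A) b)) 1
    (fun b => hM.ker_bound _ (hE i) _ _ (hF t b))
  have hψ : ∀ t i b, ψ t i b = M (ker (E i) b * Fs ℓ m t (ind A) b) := fun t i b => rfl
  have hνex : ∀ t, ∃ ν : BF →ₗ[ℂ] ℂ, ∀ f, Tendsto (fun i => M (f * ψ t i)) 𝒰 (𝓝 (ν f)) := fun t => by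
    refine ultralim 𝒰 (fun i => M.comp (LinearMap.mulRight ℂ (ψ t i))) (fun f => ‖f‖) (fun i f => ?_)
    refine hM.norm_le_const _ _ (fun n => ?_)
    simp only [LinearMap.mulRight_apply, BoundedContinuousFunction.coe_mul, Pi.mul_apply, norm_mul]
    exact (mul_le_of_le_one_right (norm_nonneg _) (psi_norm hM hE (hF t) (hψ t) i n)).trans (f.norm_coe_le_norm n)
  choose ν hν using hνex
  have hmass : ∑ t ∈ Finset.range p, ν t 1 = (p : ℂ) * M (avd ℓ (ind A)) := by
    have h1 : Tendsto (fun i => ∑ t ∈ Finset.range p, M (1 * ψ t i)) 𝒰 (𝓝 (∑ t ∈ Finset.range p, ν t 1)) :=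
      tendsto_finsetSum _ (fun t _ => hν t 1)
    refine tendsto_nhds_unique h1 ?_
    have h2 : ∀ i, ∑ t ∈ Finset.range p, M (1 * ψ t i) = (p : ℂ) * M (avd ℓ (ind A)) := fun i => by
      simp_rw [one_mul]
      exact mass hM ℓ m hℓ (ind A) (E i) (hE i) (fun t => ψ t i) (fun t b => hψ t i b)
    simp_rw [h2]
    exact tendsto_const_nhds
  have hpR : (0 : ℝ) < p := by exact_mod_cast hp0
  have hsum : ∑ t ∈ Finset.range p, (1 : ℝ) < ∑ t ∈ Finset.range p, (ν t 1 + M (dil p t (ind A))).re := by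
    rw [← Complex.re_sum, Finset.sum_add_distrib, hmass, ← Sm_apply, ← M_avd p hp0, ← mul_add, ← map_add,
      ← Complex.ofReal_natCast, Complex.re_ofReal_mul]
    simp only [Finset.sum_const, Finset.card_range, nsmul_eq_mul]
    exact mul_lt_mul_of_pos_left hM1 hpR
  obtain ⟨t, -, ht⟩ := Finset.exists_lt_of_sum_lt hsum
  have hνp := nu_pos hM (hF0 t) (hψ t) (hν t)
  set D₀ : Set ℕ := {b | p * b + t ∈ A} with hD₀
  have hdil : dil p t (ind A) = ind D₀ := by
    ext n; rw [dil_apply, ind_apply, ind_apply]; rfl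
  have h0 : ν t (ind D₀) ≠ 0 := by
    intro h0
    have h1 := nu_le hM hE (hF t) (hψ t) (hν t) (1 - ind D₀) (1 - ind D₀) (fun n => by
      simp only [BoundedContinuousFunction.coe_sub, BoundedContinuousFunction.coe_one, Pi.sub_apply, Pi.one_apply, ind_apply]
      split_ifs <;> simp)
    have h2 := (Complex.re_le_norm _).trans h1
    rw [map_sub, map_sub, h0, hM.one] at h2
    rw [hdil] at ht
    simp only [sub_zero, Complex.sub_re, Complex.one_re, Complex.add_re] at h2 ht
    linarith
  obtain ⟨B, hB, hB2⟩ := build (fun D => ν t (ind D) ≠ 0) (fun b => {b' | ℓ * b' + (m * b + t) ∈ A}) D₀ h0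
    (fun D hD N => by
      have hD' : ν t (ind (D ∩ Set.Ioi N)) ≠ 0 := by
        intro h
        apply hD
        have e : ind D = ind (D ∩ Set.Ioi N) + ind (D ∩ Set.Iic N) := by
          ext n
          simp only [BoundedContinuousFunction.coe_add, Pi.add_apply, ind_apply]
          by_cases h1 : n ∈ D <;> by_cases h2 : N < n <;> simp [h1, h2, not_le.2, not_lt.1]
        rw [e, map_add, h, zero_add, ← norm_le_zero_iff]
        have := nu_le hM hE (hF t) (hψ t) (hν t) (ind (D ∩ Set.Iic N)) (ind (Set.Iic N)) (fun n => by
          simp only [ind_apply]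
          by_cases h1 : n ∈ D <;> by_cases h2 : n ≤ N <;> simp [h1, h2])
        rwa [mean_finite hM] at this
      obtain ⟨b, hb, hb2⟩ := key hs hExt ℓ m t hm (ind A) (ind_norm A) (ind_nonneg A) hE hcE (hψ t) (hν t) _ hD'
      refine ⟨b, hb.1, hb.2, fun h => hb2 ?_⟩
      rw [← norm_le_zero_iff]
      have h3 := hνp.norm_le (ind (D ∩ Set.Ioi N) * Fs ℓ m t (ind A) b) (ind (D ∩ {b' | ℓ * b' + (m * b + t) ∈ A})) (fun n => by
        simp only [BoundedContinuousFunction.coe_mul, Pi.mul_apply, Fs_apply, ind_apply]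
        by_cases h1 : n ∈ D <;> by_cases h2 : N < n <;> by_cases h3 : ℓ * n + (m * b + t) ∈ A <;> simp [h1, h2, h3])
      rwa [h] at h3)
  refine ⟨B, hB, t, fun b₁ h1 b₂ h2 h12 => ?_⟩
  rcases hB2 b₁ h1 b₂ h2 h12 with ⟨rfl, h⟩ | h
  · have h' : p * b₁ + t ∈ A := h
    rwa [hp, add_mul] at h'
  · have h' : ℓ * b₂ + (m * b₁ + t) ∈ A := h
    rwa [show m * b₁ + ℓ * b₂ + t = ℓ * b₂ + (m * b₁ + t) by ring]

end MBLB


theorem mB_add_lB_diag_lowerDensity (ℓ m : ℕ) (hℓ : 0 < ℓ) (hm : 0 < m)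
    (A : Set ℕ) (hA : lowerDensity A > 1 / 2) :
    ∃ B : Set ℕ, B.Infinite ∧ ∃ t : ℕ, 0 < t ∧
      ∀ b₁ ∈ B, ∀ b₂ ∈ B, b₁ ≤ b₂ → m * b₁ + ℓ * b₂ + t ∈ A := by
  classical
  obtain ⟨c, hc1, hc2⟩ := exists_between hA
  have hev := Filter.eventually_lt_of_lt_liminf hc2
    ⟨0, Filter.eventually_map.2 (Filter.Eventually.of_forall fun n => by positivity)⟩
  obtain ⟨B, hB, t, h⟩ := MBLB.main ℓ m hℓ hm {n | n + 1 ∈ A} c hc1 (by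
    filter_upwards [hev] with n hn
    refine hn.le.trans (le_of_eq ?_)
    have hIcc : Finset.Icc 1 n = (Finset.range n).image (fun k => k + 1) := by
      ext k; simp only [Finset.mem_Icc, Finset.mem_image, Finset.mem_range]
      exact ⟨fun h => ⟨k - 1, by omega, by omega⟩, by rintro ⟨j, h, rfl⟩; omega⟩
    have h1 : MBLB.ces n (MBLB.ind {n | n + 1 ∈ A}) =
        (((((Finset.Icc 1 n).filter (fun x => x ∈ A)).card : ℝ) / n : ℝ) : ℂ) := by
      rw [MBLB.ces_apply, Finset.card_filter, hIcc]
      push_cast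
      rw [div_eq_inv_mul]
      congr 1
      rw [Finset.sum_image (by intro a _ b _ h; simpa using h)]
      refine Finset.sum_congr rfl fun b _ => ?_
      rw [MBLB.ind_apply]
      by_cases hb : b + 1 ∈ A <;> simp [hb]
    rw [h1, Complex.ofReal_re])
  exact ⟨B, hB, t + 1, Nat.succ_pos t, fun b₁ h1 b₂ h2 h12 => h b₁ h1 b₂ h2 h12⟩
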